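/- For n, n' ≥ 1, k, k' ≥ 2 and r, r' ≥ 1, the higher dimensional Thompson groups nV_{k,r} and n'V_{k',r'} are isomorphic as groups if and only if n = n', k = k' and gcd(k−1, r) = gcd(k'−1, r'). -/

import Mathlib

namespace NV

/-- The Cantor space `C_k = {0,…,k-1}^ℕ` of one-sided infinite sequences. -/
abbrev Cantor (k : ℕ) : Type := ℕ → Fin k

/-- Concatenation `u·x` of a finite word `u` with an infinite sequence `x`. -/
def concat {k : ℕ} (u : List (Fin k)) (x : Cantor k) : Cantor k :=
  fun i => if h : i < u.length then u.get ⟨i, h⟩ else x (i - u.length)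

/-- The space `Y(n,k,r) = (C_k)^n × {1,…,r}`. -/
abbrev Y (n k r : ℕ) : Type := (Fin n → Cantor k) × Fin r

/-- The box `{(u_1·x_1,…,u_n·x_n, a) : x_1,…,x_n ∈ C_k}` determined by
finite words `u_1,…,u_n` and an index `a`. -/
def box {n k r : ℕ} (u : Fin n → List (Fin k)) (a : Fin r) : Set (Y n k r) :=
  {y | ∃ x : Fin n → Cantor k, y = (fun i => concat (u i) (x i), a)}

/-- A permutation of `Y(n,k,r)` is an element of the higher dimensional Thompson
group `nV_{k,r}` if there are finitely many tuples of words and indices whose domain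
boxes partition `Y(n,k,r)`, whose range boxes partition `Y(n,k,r)`, and on which `γ`
acts by the corresponding prefix substitutions. -/
def IsElement {n k r : ℕ} (γ : Equiv.Perm (Y n k r)) : Prop :=
  ∃ (m : ℕ) (u v : Fin m → Fin n → List (Fin k)) (a b : Fin m → Fin r),
    (∀ y : Y n k r, ∃! t : Fin m, y ∈ box (u t) (a t)) ∧
    (∀ y : Y n k r, ∃! t : Fin m, y ∈ box (v t) (b t)) ∧
    (∀ (t : Fin m) (x : Fin n → Cantor k),
      γ (fun i => concat (u t i) (x i), a t) = (fun i => concat (v t i) (x i), b t))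

/-- The underlying set of the higher dimensional Thompson group `nV_{k,r}`,
as a set of permutations of `Y(n,k,r)`. -/
def thompsonSet (n k r : ℕ) : Set (Equiv.Perm (Y n k r)) := {γ | IsElement γ}

end NV

namespace NV

open Set Topology Filter

section Words

variable {k : ℕ}

theorem concat_nil (x : Cantor k) : concat [] x = x := by
  funext i; simp [concat]

theorem concat_of_lt {u : List (Fin k)} (x : Cantor k) {i : ℕ} (h : i < u.length) :
    concat u x i = u[i] := by
  simp [concat, h]

theorem concat_add (u : List (Fin k)) (x : Cantor k) (i : ℕ) :
    concat u x (u.length + i) = x i := by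
  simp [concat]

theorem concat_append (u v : List (Fin k)) (x : Cantor k) :
    concat (u ++ v) x = concat u (concat v x) := by
  funext i
  by_cases h1 : i < u.length
  · rw [concat_of_lt _ h1, concat_of_lt _ (by simp; omega), List.getElem_append_left h1]
  · obtain ⟨j, rfl⟩ := Nat.exists_eq_add_of_le (not_lt.mp h1)
    rw [concat_add]
    by_cases h2 : j < v.length
    · rw [concat_of_lt _ h2, concat_of_lt _ (by simp; omega), List.getElem_append_right (by omega)]
      simp
    · obtain ⟨l, rfl⟩ := Nat.exists_eq_add_of_le (not_lt.mp h2)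
      rw [concat_add, ← Nat.add_assoc, ← List.length_append, concat_add]

theorem concat_injective (u : List (Fin k)) : Function.Injective (concat u) := fun x y h => by
  funext i
  rw [← concat_add u x i, h, concat_add]

theorem concat_eq_concat {u v : List (Fin k)} {x y : Cantor k} (h : concat u x = concat v y)
    (hl : u.length ≤ v.length) : ∃ t, v = u ++ t ∧ x = concat t y := by
  have hv : v = u ++ v.drop u.length := by
    refine List.ext_getElem (by simp; omega) fun i h1 h2 => ?_
    by_cases hi : i < u.length
    · rw [List.getElem_append_left hi, ← concat_of_lt y h1, ← h, concat_of_lt x hi]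
    · rw [List.getElem_append_right (by omega), List.getElem_drop]
      congr 1; omega
  refine ⟨_, hv, concat_injective u ?_⟩
  rw [h, ← concat_append, ← hv]

/-- The first `N` letters of a sequence. -/
def pre (N : ℕ) (x : Cantor k) : List (Fin k) := List.ofFn fun i : Fin N => x i

theorem length_pre (N : ℕ) (x : Cantor k) : (pre N x).length = N := by simp [pre]

theorem concat_ofFn {N : ℕ} (w : Fin N → Fin k) (x : Cantor k) (i : Fin N) :
    concat (List.ofFn w) x i = w i := by
  rw [concat_of_lt _ (by simp)]; simp

theorem concat_pre (N : ℕ) (x : Cantor k) : concat (pre N x) (fun i => x (N + i)) = x := by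
  funext i
  by_cases h : i < N
  · exact concat_ofFn (fun i : Fin N => x i) _ ⟨i, h⟩
  · obtain ⟨j, rfl⟩ := Nat.exists_eq_add_of_le (not_lt.mp h)
    have := concat_add (pre N x) (fun i => x (N + i)) j
    rwa [length_pre] at this

theorem exists_concat_iff {u : List (Fin k)} {x : Cantor k} :
    (∃ z, x = concat u z) ↔ ∀ i (h : i < u.length), x i = u[i] := by
  constructor
  · rintro ⟨z, rfl⟩ i h
    exact concat_of_lt z h
  · intro h
    refine ⟨fun i => x (u.length + i), ?_⟩
    funext i
    by_cases hi : i < u.length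
    · rw [concat_of_lt _ hi, h]
    · obtain ⟨j, rfl⟩ := Nat.exists_eq_add_of_le (not_lt.mp hi)
      rw [concat_add]

theorem continuous_concat (u : List (Fin k)) : Continuous (concat u) := by
  refine continuous_pi fun i => ?_
  by_cases h : i < u.length
  · simp only [concat_of_lt _ h]; exact continuous_const
  · obtain ⟨j, rfl⟩ := Nat.exists_eq_add_of_le (not_lt.mp h)
    simp only [concat_add]; exact continuous_apply j

end Words

/-- The data of a box. -/
abbrev Chart (n k r : ℕ) : Type := (Fin n → List (Fin k)) × Fin r

section Charts

variable {n k r : ℕ}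

/-- The parametrization of the box of `c`. -/
def app (c : Chart n k r) (x : Fin n → Cantor k) : Y n k r := (fun i => concat (c.1 i) (x i), c.2)

theorem app_injective (c : Chart n k r) : Function.Injective (app c) := fun x y h => by
  funext i
  exact concat_injective (c.1 i) (congrFun (congrArg Prod.fst h) i)

theorem mem_range_app {c : Chart n k r} {y : Y n k r} :
    y ∈ range (app c) ↔ y.2 = c.2 ∧ ∀ i j (h : j < (c.1 i).length), y.1 i j = (c.1 i)[j] := by
  simp only [← exists_concat_iff]
  constructor
  · rintro ⟨x, rfl⟩
    exact ⟨rfl, fun i => ⟨x i, rfl⟩⟩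
  · rintro ⟨h1, h2⟩
    choose z hz using h2
    exact ⟨z, Prod.ext (funext fun i => (hz i).symm) h1.symm⟩

/-- The chart obtained by lengthening the words of `c`. -/
def ext (c : Chart n k r) (t : Fin n → List (Fin k)) : Chart n k r := (fun i => c.1 i ++ t i, c.2)

theorem app_ext (c : Chart n k r) (t : Fin n → List (Fin k)) (x : Fin n → Cantor k) :
    app (ext c t) x = app c fun i => concat (t i) (x i) := by
  simp [app, ext, concat_append]

theorem range_app_ext (c : Chart n k r) (t : Fin n → List (Fin k)) :
    range (app (ext c t)) ⊆ range (app c) := by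
  rintro _ ⟨x, rfl⟩
  exact ⟨_, (app_ext c t x).symm⟩

theorem continuous_app (c : Chart n k r) : Continuous (app c) :=
  (continuous_pi fun i => (continuous_concat _).comp (continuous_apply i)).prodMk continuous_const

/-- The index type of the boxes all of whose words have length `N`. -/
abbrev Cell (n k r N : ℕ) : Type := (Fin n → Fin N → Fin k) × Fin r

/-- The chart of a box all of whose words have length `N`. -/
def cell {N : ℕ} (w : Cell n k r N) : Chart n k r := (fun i => List.ofFn (w.1 i), w.2)

/-- The box of depth `N` containing a point. -/
def code (N : ℕ) (y : Y n k r) : Cell n k r N := (fun i j => y.1 i j, y.2)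

/-- The coordinates of a point inside its box of depth `N`. -/
def rest (N : ℕ) (y : Y n k r) : Fin n → Cantor k := fun i j => y.1 i (N + j)

theorem app_cell_code (N : ℕ) (y : Y n k r) : app (cell (code N y)) (rest N y) = y :=
  Prod.ext (funext fun i => concat_pre N (y.1 i)) rfl

theorem code_app_cell {N : ℕ} (w : Cell n k r N) (x : Fin n → Cantor k) :
    code N (app (cell w) x) = w :=
  Prod.ext (funext fun i => funext fun j => concat_ofFn (w.1 i) (x i) j) rfl

theorem mem_range_cell {N : ℕ} {w : Cell n k r N} {y : Y n k r} :
    y ∈ range (app (cell w)) ↔ code N y = w := by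
  constructor
  · rintro ⟨x, rfl⟩
    exact code_app_cell w x
  · rintro rfl
    exact ⟨_, app_cell_code N y⟩

theorem continuous_code (N : ℕ) : Continuous (code N : Y n k r → Cell n k r N) := by
  unfold code
  fun_prop

/-- A point of `range (app c)` has all its deep boxes inside `c`. -/
theorem exists_cell_eq_ext {c : Chart n k r} {y : Y n k r} (hy : y ∈ range (app c)) {N : ℕ}
    (hN : ∀ i, (c.1 i).length ≤ N) : ∃ t, cell (code N y) = ext c t := by
  obtain ⟨x, rfl⟩ := hy
  have h : ∀ i, ∃ t, pre N (concat (c.1 i) (x i)) = c.1 i ++ t := fun i => by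
    obtain ⟨t, ht, -⟩ := concat_eq_concat (concat_pre N (concat (c.1 i) (x i))).symm
      (by rw [length_pre]; exact hN i)
    exact ⟨t, ht⟩
  choose t ht using h
  exact ⟨t, Prod.ext (funext ht) rfl⟩

theorem exists_length_le (c : Chart n k r) : ∃ N, ∀ i, (c.1 i).length ≤ N :=
  ⟨Finset.univ.sup fun i => (c.1 i).length, fun i =>
    Finset.le_sup (f := fun i => (c.1 i).length) (Finset.mem_univ i)⟩

theorem isOpen_range_app (c : Chart n k r) : IsOpen (range (app c)) := by
  obtain ⟨N, hN⟩ := exists_length_le c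
  refine isOpen_iff_mem_nhds.2 fun y hy => ?_
  obtain ⟨t, ht⟩ := exists_cell_eq_ext hy hN
  have : (code N) ⁻¹' {code N y} ∈ 𝓝 y :=
    ((isOpen_discrete {code N y}).preimage (continuous_code N)).mem_nhds rfl
  filter_upwards [this] with z hz
  have := mem_range_cell.2 (show code N z = code N y from hz)
  rw [ht] at this
  exact range_app_ext c t this

theorem isClosed_range_app (c : Chart n k r) : IsClosed (range (app c)) :=
  (isCompact_range (continuous_app c)).isClosed

theorem isClopen_range_app (c : Chart n k r) : IsClopen (range (app c)) :=
  ⟨isClosed_range_app c, isOpen_range_app c⟩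

/-- Boxes of large depth are small. -/
theorem exists_cell_subset {y : Y n k r} {U : Set (Y n k r)} (hU : U ∈ 𝓝 y) :
    ∃ N, ∀ M ≥ N, range (app (cell (code M y))) ⊆ U := by
  by_contra! h
  choose M hM h using h
  have : ∀ N, ∃ z, code (M N) z = code (M N) y ∧ z ∉ U := fun N => by
    obtain ⟨z, hz, hzU⟩ := not_subset.1 (h N)
    exact ⟨z, mem_range_cell.1 hz, hzU⟩
  choose z hz hzU using this
  have hlim : Tendsto z atTop (𝓝 y) := by
    refine Prod.tendsto_iff _ _ |>.2 ⟨?_, ?_⟩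
    · refine tendsto_pi_nhds.2 fun i => tendsto_pi_nhds.2 fun j => ?_
      refine tendsto_const_nhds.congr' ?_
      filter_upwards [eventually_gt_atTop j] with N hN
      exact (congrFun (congrFun (congrArg Prod.fst (hz N)) i) ⟨j, hN.trans_le (hM N)⟩).symm
    · refine tendsto_const_nhds.congr fun N => ?_
      exact (congrArg Prod.snd (hz N)).symm
  obtain ⟨N, hN⟩ := (hlim.eventually hU).exists
  exact hzU N hN

theorem exists_code_eq [NeZero k] {N : ℕ} (w : Cell n k r N) : ∃ y, code N y = w :=
  ⟨_, code_app_cell w fun _ _ => 0⟩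

/-- A hereditary property of boxes that holds locally holds at some depth. -/
theorem exists_depth [NeZero k] {Q : Chart n k r → Prop} (hQ : ∀ c t, Q c → Q (ext c t))
    (h : ∀ y, ∃ c, y ∈ range (app c) ∧ Q c) : ∃ N, ∀ w : Cell n k r N, Q (cell w) := by
  have hmono : ∀ (y : Y n k r) (M N : ℕ), M ≤ N → Q (cell (code M y)) → Q (cell (code N y)) := by
    intro y M N hMN hq
    obtain ⟨t, ht⟩ := exists_cell_eq_ext (N := N) (mem_range_cell.2 (rfl : code M y = code M y))
      (fun i => by simpa [cell] using hMN)
    rw [ht]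
    exact hQ _ _ hq
  have hcov : (univ : Set (Y n k r)) ⊆ ⋃ N, {y | Q (cell (code N y))} := fun y _ => by
    obtain ⟨c, hy, hc⟩ := h y
    obtain ⟨N, hN⟩ := exists_length_le c
    obtain ⟨t, ht⟩ := exists_cell_eq_ext hy hN
    exact mem_iUnion.2 ⟨N, by simpa [ht] using hQ c t hc⟩
  obtain ⟨N, hN⟩ := isCompact_univ.elim_directed_cover
    (fun N => {y : Y n k r | Q (cell (code N y))})
    (fun N => (isOpen_discrete {w : Cell n k r N | Q (cell w)}).preimage (continuous_code N)) hcov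
    (directed_of_isDirected_le fun M N hMN y hy => hmono y M N hMN hy)
  refine ⟨N, fun w => ?_⟩
  obtain ⟨y, rfl⟩ := exists_code_eq w
  exact hN (mem_univ y)

end Charts

section Loc

variable {n k r r' r'' : ℕ}

/-- Maps that are locally given by prefix substitutions. -/
def Loc (f : Y n k r → Y n k r') : Prop :=
  ∀ y, ∃ (c : Chart n k r) (d : Chart n k r') (x : Fin n → Cantor k),
    y = app c x ∧ ∀ x', f (app c x') = app d x'

theorem Loc.id : Loc (_root_.id : Y n k r → Y n k r) := fun y =>
  ⟨cell (code 0 y), cell (code 0 y), _, (app_cell_code 0 y).symm, fun _ => rfl⟩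

/-- Two charts at a common point have a common refinement. -/
theorem exists_ext_eq_ext {d c : Chart n k r} {x z : Fin n → Cantor k} (h : app d x = app c z) :
    ∃ (s t : Fin n → List (Fin k)) (x' : Fin n → Cantor k), ext d s = ext c t ∧
      x = (fun i => concat (s i) (x' i)) ∧
      z = (fun i => concat (t i) (x' i)) := by
  have : ∀ i, ∃ s t y, d.1 i ++ s = c.1 i ++ t ∧ x i = concat s y ∧ z i = concat t y := fun i => by
    have hi : concat (d.1 i) (x i) = concat (c.1 i) (z i) := congrFun (congrArg Prod.fst h) i
    rcases le_total (d.1 i).length (c.1 i).length with hl | hl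
    · obtain ⟨s, hs, hx⟩ := concat_eq_concat hi hl
      exact ⟨s, [], z i, by simp [hs], hx, (concat_nil _).symm⟩
    · obtain ⟨s, hs, hx⟩ := concat_eq_concat hi.symm hl
      exact ⟨[], s, x i, by simp [hs], (concat_nil _).symm, hx⟩
  choose s t y h1 h2 h3 using this
  have h4 : (app d x).2 = (app c z).2 := congrArg Prod.snd h
  exact ⟨s, t, y, Prod.ext (funext h1) h4, funext h2, funext h3⟩

theorem Loc.comp {g : Y n k r' → Y n k r''} {f : Y n k r → Y n k r'} (hg : Loc g) (hf : Loc f) :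
    Loc (g ∘ f) := fun y => by
  obtain ⟨c, d, x, rfl, h⟩ := hf y
  obtain ⟨c', d', x', e, h'⟩ := hg (app d x)
  obtain ⟨s, t, z, hst, rfl, rfl⟩ := exists_ext_eq_ext e
  refine ⟨ext c s, ext d' t, z, (app_ext _ _ _).symm, fun z' => ?_⟩
  rw [Function.comp_apply, app_ext, h, ← app_ext, hst, app_ext, h', app_ext]

theorem Loc.symm {f : Y n k r ≃ Y n k r'} (hf : Loc f) : Loc f.symm := fun y => by
  obtain ⟨c, d, x, e, h⟩ := hf (f.symm y)
  refine ⟨d, c, x, ?_, fun x' => ?_⟩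
  · rw [← h, ← e, Equiv.apply_symm_apply]
  · rw [← h, Equiv.symm_apply_apply]

theorem Loc.continuous {f : Y n k r → Y n k r'} (hf : Loc f) : Continuous f := by
  refine continuous_iff_continuousAt.2 fun y => ?_
  obtain ⟨c, d, x, rfl, h⟩ := hf y
  have hc : IsOpenEmbedding (app c) :=
    ⟨((continuous_app c).isClosedEmbedding (app_injective c)).isEmbedding, isOpen_range_app c⟩
  refine hc.continuousAt_iff.1 ?_
  have : f ∘ app c = app d := funext h
  rw [this]
  exact (continuous_app d).continuousAt

/-- A prefix substitution can be read off on arbitrarily small boxes. -/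
theorem Loc.hereditary {f : Y n k r → Y n k r'} {c : Chart n k r} (t : Fin n → List (Fin k))
    (h : ∃ d, ∀ x', f (app c x') = app d x') : ∃ d, ∀ x', f (app (ext c t) x') = app d x' := by
  obtain ⟨d, hd⟩ := h
  exact ⟨ext d t, fun x => by rw [app_ext, hd, app_ext]⟩

theorem isElement_iff [NeZero k] {γ : Equiv.Perm (Y n k r)} : IsElement γ ↔ Loc γ := by
  constructor
  · rintro ⟨m, u, v, a, b, h1, -, h3⟩ y
    obtain ⟨t, ⟨x, hx⟩, -⟩ := h1 y
    exact ⟨(u t, a t), (v t, b t), x, hx, h3 t⟩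
  · intro h
    obtain ⟨N, hN⟩ := exists_depth (Q := fun c => ∃ d, ∀ x', γ (app c x') = app d x')
      (fun c t => Loc.hereditary t) fun y => by
        obtain ⟨c, d, x, e, h⟩ := h y
        exact ⟨c, ⟨x, e.symm⟩, d, h⟩
    choose d hd using hN
    let e := Fintype.equivFin (Cell n k r N)
    have key : ∀ y : Y n k r, ∃! t, y ∈ range (app (cell (e.symm t))) := fun y => by
      refine ⟨e (code N y), ?_, fun t ht => ?_⟩
      · simpa using ⟨_, app_cell_code N y⟩
      · rw [mem_range_cell.1 ht, Equiv.apply_symm_apply]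
    refine ⟨Fintype.card (Cell n k r N), fun t => (cell (e.symm t)).1, fun t => (d (e.symm t)).1,
      fun t => (cell (e.symm t)).2, fun t => (d (e.symm t)).2, fun y => ?_, fun y => ?_,
      fun t x => hd _ x⟩
    · obtain ⟨t, ⟨x, hx⟩, ht'⟩ := key y
      exact ⟨t, ⟨x, hx.symm⟩, fun s ⟨x', hx'⟩ => ht' s ⟨x', hx'.symm⟩⟩
    · obtain ⟨t, ⟨x, hx⟩, ht'⟩ := key (γ.symm y)
      refine ⟨t, ⟨x, ?_⟩, fun s ⟨x', hx'⟩ => ht' s ⟨x', ?_⟩⟩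
      · change y = app (d (e.symm t)) x
        rw [← hd, hx, Equiv.apply_symm_apply]
      · rw [Equiv.eq_symm_apply, hd]; exact hx'.symm

end Loc

end NV

set_option linter.unusedSectionVars false

namespace Rubin

open Set Topology Filter

/-- A faithful action on a space by homeomorphisms which is stable under patching and has enough
local elements for the space to be reconstructed from the group. -/
class Ample (G X : Type*) [Group G] [MulAction G X] [TopologicalSpace X] : Prop where
  cont : ∀ g : G, Continuous fun x : X => g • x
  faithful : ∀ g : G, (∀ x : X, g • x = x) → g = 1
  full : ∀ γ : Equiv.Perm X, (∀ x, ∃ g : G, ∀ᶠ y in 𝓝 x, γ y = g • y) → ∃ g : G, ∀ x, g • x = γ x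
  rich : ∀ x : X, ∀ U ∈ 𝓝 x, ∃ g : G, g • x ∈ U ∧ g • x ≠ x
  invol : ∀ g : G, g * g = 1 → IsOpen {x : X | g • x = x}

section Local

variable {G X : Type*} [Group G] [MulAction G X] [TopologicalSpace X] [CompactSpace X] [T2Space X]
  [TotallyDisconnectedSpace X]

theorem smul_smul_self {π : G} (h : π * π = 1) (x : X) : π • π • x = x := by
  rw [smul_smul, h, one_smul]

theorem exists_isClopen {x : X} {U : Set X} (hU : U ∈ 𝓝 x) : ∃ V, IsClopen V ∧ x ∈ V ∧ V ⊆ U := by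
  obtain ⟨O, hO, ho, hx⟩ := mem_nhds_iff.1 hU
  obtain ⟨V, hV, hxV, hVO⟩ := compact_exists_isClopen_in_isOpen ho hx
  exact ⟨V, hV, hxV, hVO.trans hO⟩

theorem eventually_separated {f : X → X} (hf : Continuous f) {x : X} (h : f x ≠ x) :
    ∃ U ∈ 𝓝 x, ∀ y ∈ U, f y ∉ U := by
  obtain ⟨A, B, hA, hB, hxA, hxB, hd⟩ := t2_separation h
  refine ⟨B ∩ f ⁻¹' A, inter_mem (hB.mem_nhds hxB) (hf.continuousAt (hA.mem_nhds hxA)), ?_⟩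
  exact fun y hy hy' => (disjoint_left.1 hd) hy.2 hy'.1

variable [Ample G X]

theorem ext_smul {g h : G} (H : ∀ x : X, g • x = h • x) : g = h := by
  refine inv_mul_eq_one.1 (Ample.faithful (X := X) _ fun x => ?_)
  rw [mul_smul, ← H, inv_smul_smul]

/-- An element moving a clopen set off itself can be cut down to an involution. -/
theorem exists_swap (g : G) {V : Set X} (hV : IsClopen V) (hd : ∀ x ∈ V, g • x ∉ V) :
    ∃ s : G, s * s = 1 ∧ (∀ x ∈ V, s • x = g • x) ∧ ∀ x, x ∉ V → g⁻¹ • x ∉ V → s • x = x := by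
  classical
  let f : X → X := fun x => if x ∈ V then g • x else if g⁻¹ • x ∈ V then g⁻¹ • x else x
  have f1 : ∀ x ∈ V, f x = g • x := fun x hx => if_pos hx
  have f2 : ∀ x, x ∉ V → g⁻¹ • x ∈ V → f x = g⁻¹ • x := fun x hx hx' => by
    simp only [f, if_neg hx, if_pos hx']
  have f3 : ∀ x, x ∉ V → g⁻¹ • x ∉ V → f x = x := fun x hx hx' => by
    simp only [f, if_neg hx, if_neg hx']
  have hf : Function.Involutive f := fun x => by
    by_cases h1 : x ∈ V
    · rw [f1 x h1, f2 _ (hd x h1) (by simpa using h1), inv_smul_smul]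
    · by_cases h2 : g⁻¹ • x ∈ V
      · rw [f2 x h1 h2, f1 _ h2, smul_inv_smul]
      · rw [f3 x h1 h2, f3 x h1 h2]
  have hV' : IsClopen ((fun x => g⁻¹ • x) ⁻¹' V) := hV.preimage (Ample.cont g⁻¹)
  obtain ⟨s, hs⟩ := Ample.full (G := G) hf.toPerm fun x => by
    by_cases h1 : x ∈ V
    · exact ⟨g, by filter_upwards [hV.isOpen.mem_nhds h1] with y hy using f1 y hy⟩
    · by_cases h2 : g⁻¹ • x ∈ V
      · refine ⟨g⁻¹, ?_⟩
        filter_upwards [hV.compl.isOpen.mem_nhds h1, hV'.isOpen.mem_nhds h2] with y hy hy'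
          using f2 y hy hy'
      · refine ⟨1, ?_⟩
        filter_upwards [hV.compl.isOpen.mem_nhds h1, hV'.compl.isOpen.mem_nhds h2] with y hy hy'
        rw [one_smul]
        exact f3 y hy hy'
  refine ⟨s, ext_smul (X := X) fun x => ?_, fun x hx => (hs x).trans (f1 x hx),
    fun x hx hx' => (hs x).trans (f3 x hx hx')⟩
  rw [mul_smul, one_smul, hs, hs]
  exact hf x

/-- Restriction of an involution to an invariant clopen set. -/
theorem exists_restrict {π : G} (hπ : π * π = 1) {B : Set X} (hB : IsClopen B)
    (hi : ∀ x ∈ B, π • x ∈ B) :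
    ∃ s : G, s * s = 1 ∧ (∀ x ∈ B, s • x = π • x) ∧ ∀ x, x ∉ B → s • x = x := by
  classical
  let f : X → X := fun x => if x ∈ B then π • x else x
  have f1 : ∀ x ∈ B, f x = π • x := fun x hx => if_pos hx
  have f2 : ∀ x, x ∉ B → f x = x := fun x hx => if_neg hx
  have hf : Function.Involutive f := fun x => by
    by_cases h1 : x ∈ B
    · rw [f1 x h1, f1 _ (hi x h1), smul_smul_self hπ]
    · rw [f2 x h1, f2 x h1]
  obtain ⟨s, hs⟩ := Ample.full (G := G) hf.toPerm fun x => by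
    by_cases h1 : x ∈ B
    · exact ⟨π, by filter_upwards [hB.isOpen.mem_nhds h1] with y hy using f1 y hy⟩
    · refine ⟨1, ?_⟩
      filter_upwards [hB.compl.isOpen.mem_nhds h1] with y hy
      rw [one_smul]
      exact f2 y hy
  refine ⟨s, ext_smul (X := X) fun x => ?_, fun x hx => (hs x).trans (f1 x hx),
    fun x hx => (hs x).trans (f2 x hx)⟩
  rw [mul_smul, one_smul, hs, hs]
  exact hf x

variable (G) in
theorem exists_small_involution {x : X} {U : Set X} (hU : U ∈ 𝓝 x) :
    ∃ s : G, s * s = 1 ∧ s • x ≠ x ∧ ∀ y, y ∉ U → s • y = y := by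
  obtain ⟨O, hO, ho, hx⟩ := mem_nhds_iff.1 hU
  obtain ⟨g, hgU, hgx⟩ := Ample.rich (G := G) x O (ho.mem_nhds hx)
  obtain ⟨A, hA, hAd⟩ := eventually_separated (Ample.cont g) hgx
  obtain ⟨V, hV, hxV, hVA⟩ := exists_isClopen (inter_mem (inter_mem hA hU)
    ((ho.preimage (Ample.cont g)).mem_nhds hgU))
  obtain ⟨s, hs, h1, h2⟩ := exists_swap g hV fun y hy hy' => hAd y (hVA hy).1.1 (hVA hy').1.1
  refine ⟨s, hs, by rwa [h1 x hxV], fun y hy => h2 y (fun h => hy (hVA h).1.2) fun h => hy ?_⟩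
  simpa using hO (hVA h).2

theorem mem_of_smul_ne {s : G} {U : Set X} (hs : ∀ y, y ∉ U → s • y = y) {y : X}
    (h : s • y ≠ y) : y ∈ U := by_contra fun h' => h (hs y h')

theorem smul_mem_of_support {s : G} {U : Set X} (hs : ∀ y, y ∉ U → s • y = y) {y : X}
    (h : y ∈ U) : s • y ∈ U := by
  by_contra h'
  have := smul_left_cancel s (hs _ h')
  exact h' (this.symm ▸ h)

variable (G) in
theorem exists_small_order {x : X} {U : Set X} (hU : U ∈ 𝓝 x) :
    ∃ s : G, s • s • x ≠ x ∧ ∀ y, y ∉ U → s • y = y := by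
  obtain ⟨O, hO, ho, hxO⟩ := mem_nhds_iff.1 hU
  obtain ⟨s, hs, hx, hsO⟩ := exists_small_involution G (ho.mem_nhds hxO)
  have hy : s • x ∈ O := smul_mem_of_support hsO hxO
  obtain ⟨t, ht, hty, htO⟩ := exists_small_involution G
    (inter_mem (ho.mem_nhds hy) (isOpen_compl_singleton.mem_nhds (show s • x ∈ {x}ᶜ from hx)))
  have htx : t • x = x := htO x fun h => h.2 rfl
  refine ⟨t * s, fun h => ?_, fun y hyU => ?_⟩
  · rw [mul_smul, mul_smul] at h
    have h1 : s • t • s • x = x := smul_left_cancel t (h.trans htx.symm)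
    have h2 := congrArg (s • ·) h1
    simp only [smul_smul_self hs] at h2
    exact hty h2
  · rw [mul_smul, hsO y fun h => hyU (hO h), htO y fun h => hyU (hO h.1)]

theorem exists_commuting_order {π : G} (hπ : π * π = 1) {x : X} {U : Set X} (hU : U ∈ 𝓝 x) :
    ∃ ψ : G, ψ * π = π * ψ ∧ (∀ y, y ∉ U → π • y ∉ U → ψ • y = y) ∧ ψ • x ∈ U ∧
      ψ • ψ • x ≠ x := by
  by_cases hx : π • x = x
  · obtain ⟨s, hsx, hs⟩ := exists_small_order G (inter_mem hU
      ((Ample.invol π hπ).mem_nhds hx))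
    refine ⟨s, ext_smul (X := X) fun y => ?_, fun y hy _ => hs y fun h => hy h.1,
      (smul_mem_of_support hs ⟨mem_of_mem_nhds hU, hx⟩).1, hsx⟩
    rw [mul_smul, mul_smul]
    by_cases hy : y ∈ U ∩ {x | π • x = x}
    · rw [show π • y = y from hy.2, show π • s • y = s • y from (smul_mem_of_support hs hy).2]
    · rw [hs y hy, hs]
      intro h
      have : π • y = y := smul_left_cancel π h.2
      exact hy (this ▸ h)
  · obtain ⟨A, hA, hAd⟩ := eventually_separated (Ample.cont π) hx
    obtain ⟨s, hsx, hs⟩ := exists_small_order G (inter_mem hU hA)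
    have hd : ∀ y ∈ U ∩ A, π • y ∉ U ∩ A := fun y hy hy' => hAd y hy.2 hy'.2
    have hcom : s * (π * s * π) = π * s * π * s := ext_smul (X := X) fun y => by
      simp only [mul_smul]
      by_cases h1 : y ∈ U ∩ A
      · rw [hs _ (hd y h1), smul_smul_self hπ, hs _ (hd _ (smul_mem_of_support hs h1)),
          smul_smul_self hπ]
      · rw [hs y h1]
        by_cases h2 : π • y ∈ U ∩ A
        · exact hs _ (hd _ (smul_mem_of_support hs h2))
        · rw [hs _ h2, smul_smul_self hπ, hs y h1]
    have hψ : ∀ y ∈ U ∩ A, (s * (π * s * π)) • y = s • y := fun y hy => by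
      simp only [mul_smul]
      rw [hs _ (hd y hy), smul_smul_self hπ]
    have hxU : x ∈ U ∩ A := ⟨mem_of_mem_nhds hU, mem_of_mem_nhds hA⟩
    refine ⟨s * (π * s * π), ?_, fun y h1 h2 => ?_, ?_, ?_⟩
    · calc s * (π * s * π) * π = s * π * s * (π * π) := by group
        _ = (π * π) * s * π * s := by rw [hπ]; group
        _ = π * (π * s * π * s) := by group
        _ = _ := by rw [hcom]
    · simp only [mul_smul]
      rw [hs _ fun h => h2 h.1, smul_smul_self hπ, hs _ fun h => h1 h.1]
    · rw [hψ x hxU]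
      exact (smul_mem_of_support hs hxU).1
    · rw [hψ x hxU, hψ _ (smul_mem_of_support hs hxU)]
      exact hsx

end Local

section Algebra

variable {G H : Type*} [Group G] [Group H]

/-- The involutions commuting with all their conjugates by the centralizer of `π`. -/
def InvolSet (π : G) : Set G :=
  {φ | φ * π = π * φ ∧ φ * φ = 1 ∧ ∀ ψ, ψ * π = π * ψ → φ * (ψ * φ * ψ⁻¹) = ψ * φ * ψ⁻¹ * φ}

/-- The centralizer of `InvolSet π`. -/
def CentSet (π : G) : Set G := {φ | ∀ u ∈ InvolSet π, φ * u = u * φ}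

/-- An algebraic description of the elements whose support lies in that of `π`. -/
def SuppSet (π : G) : Set G := {g | ∀ φ ∈ CentSet π, g * (φ * φ) = φ * φ * g}

theorem map_mem_involSet (Φ : G ≃* H) {π φ : G} (h : φ ∈ InvolSet π) :
    Φ φ ∈ InvolSet (Φ π) := by
  obtain ⟨h1, h2, h3⟩ := h
  refine ⟨by rw [← map_mul, h1, map_mul], by rw [← map_mul, h2, map_one], fun ψ hψ => ?_⟩
  have := congrArg Φ (h3 (Φ.symm ψ) (Φ.injective (by simpa using hψ)))
  simpa using this

theorem map_mem_centSet (Φ : G ≃* H) {π φ : G} (h : φ ∈ CentSet π) :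
    Φ φ ∈ CentSet (Φ π) := fun u hu => by
  have h1 : Φ.symm u ∈ InvolSet π := by simpa using map_mem_involSet Φ.symm hu
  simpa using congrArg Φ (h _ h1)

theorem map_mem_suppSet (Φ : G ≃* H) {π φ : G} (h : φ ∈ SuppSet π) :
    Φ φ ∈ SuppSet (Φ π) := fun u hu => by
  have h1 : Φ.symm u ∈ CentSet π := by simpa using map_mem_centSet Φ.symm hu
  simpa using congrArg Φ (h _ h1)

theorem map_mem_suppSet_iff (Φ : G ≃* H) {π φ : G} : Φ φ ∈ SuppSet (Φ π) ↔ φ ∈ SuppSet π :=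
  ⟨fun h => by simpa using map_mem_suppSet Φ.symm h, map_mem_suppSet Φ⟩

end Algebra

section Support

variable {G X : Type*} [Group G] [MulAction G X] [TopologicalSpace X] [CompactSpace X] [T2Space X]
  [TotallyDisconnectedSpace X] [Ample G X]

variable (X) in
theorem mem_involSet {π φ : G} (h1 : φ * π = π * φ) (h2 : φ * φ = 1)
    (h : ∀ x : X, φ • x = x ∨ φ • x = π • x) : φ ∈ InvolSet π := by
  refine ⟨h1, h2, fun ψ hψ => ?_⟩
  have hψ' : ψ⁻¹ * π = π * ψ⁻¹ := by
    rw [inv_mul_eq_iff_eq_mul, ← mul_assoc, hψ, mul_inv_cancel_right]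
  have h' : ∀ x : X, (ψ * φ * ψ⁻¹) • x = x ∨ (ψ * φ * ψ⁻¹) • x = π • x := fun x => by
    rcases h (ψ⁻¹ • x) with hx | hx
    · left; rw [mul_smul, mul_smul, hx, smul_inv_smul]
    · right; rw [mul_smul, mul_smul, hx, ← mul_smul ψ π, hψ, mul_smul, smul_inv_smul]
  have h3 : ψ * φ * ψ⁻¹ * π = π * (ψ * φ * ψ⁻¹) := by
    rw [mul_assoc, hψ', ← mul_assoc, mul_assoc ψ, h1, ← mul_assoc, hψ]; group
  generalize ψ * φ * ψ⁻¹ = φ' at *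
  refine ext_smul (X := X) fun x => ?_
  have e1 : φ • π • x = π • φ • x := by rw [← mul_smul, h1, mul_smul]
  have e3 : φ' • π • x = π • φ' • x := by rw [← mul_smul, h3, mul_smul]
  rw [mul_smul, mul_smul]
  rcases h x with hx | hx <;> rcases h' x with hx' | hx' <;> simp [hx, hx', e1, e3]

theorem smul_eq_or_of_mem_involSet {π φ : G} (hπ : π * π = 1) (h : φ ∈ InvolSet π) (x : X) :
    φ • x = x ∨ φ • x = π • x := by
  obtain ⟨h1, h2, h3⟩ := h
  by_contra! hx
  have e1 : ∀ y : X, φ • π • y = π • φ • y := fun y => by rw [← mul_smul, h1, mul_smul]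
  obtain ⟨A, hA, hAd⟩ := eventually_separated (Ample.cont φ) hx.1
  obtain ⟨B, hB, hBd⟩ := eventually_separated (Ample.cont (π * φ)) (x := x) (fun h => hx.2 (by
    rw [← smul_smul_self hπ (φ • x), ← mul_smul π φ, h]))
  obtain ⟨ψ, hψ, hs, hψU, hψx⟩ := exists_commuting_order hπ (inter_mem hA hB)
  have hfix : ∀ y ∈ A ∩ B, ψ • φ • y = φ • y := fun y hy =>
    hs _ (fun h => hAd y hy.1 h.1) fun h => hBd y hy.2 (by simpa only [mul_smul] using h.2)
  have key := congrArg (· • ψ • x) (h3 ψ hψ)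
  simp only [mul_smul, inv_smul_smul] at key
  rw [hfix x (mem_of_mem_nhds (inter_mem hA hB)), smul_smul_self h2,
    inv_smul_eq_iff.2 (hfix _ hψU).symm, smul_smul_self h2] at key
  exact hψx key.symm

theorem smul_eq_or_of_mem_centSet {π φ : G} (hπ : π * π = 1) (h : φ ∈ CentSet π) {x : X}
    (hx : π • x ≠ x) : φ • x = x ∨ φ • x = π • x := by
  by_contra! hc
  have hc' : π • φ • x ≠ x := fun h' => hc.2 (by rw [← h', smul_smul_self hπ, h'])
  obtain ⟨V, hV, hxV, hVs⟩ := exists_isClopen (inter_mem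
    (isOpen_compl_singleton.mem_nhds (show x ∈ {φ • x}ᶜ from hc.1.symm))
    (isOpen_compl_singleton.mem_nhds (show x ∈ {π • φ • x}ᶜ from hc'.symm)))
  have hB : IsClopen (V ∪ (fun y => π • y) ⁻¹' V) := hV.union (hV.preimage (Ample.cont π))
  have hBi : ∀ y ∈ V ∪ (fun y => π • y) ⁻¹' V, π • y ∈ V ∪ (fun y => π • y) ⁻¹' V := by
    rintro y (hy | hy)
    · right; simpa only [mem_preimage, smul_smul_self hπ] using hy
    · left; exact hy
  obtain ⟨s, hs, hs1, hs2⟩ := exists_restrict hπ hB hBi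
  have hsU : s ∈ InvolSet π := by
    refine mem_involSet X (ext_smul (X := X) fun y => ?_) hs fun y => ?_
    · rw [mul_smul, mul_smul]
      by_cases hy : y ∈ V ∪ (fun y => π • y) ⁻¹' V
      · rw [hs1 y hy, hs1 _ (hBi y hy)]
      · rw [hs2 y hy, hs2]
        intro h'
        exact hy (by simpa only [smul_smul_self hπ] using hBi _ h')
    · by_cases hy : y ∈ V ∪ (fun y => π • y) ⁻¹' V
      · exact .inr (hs1 y hy)
      · exact .inl (hs2 y hy)
  have key := congrArg (· • x) (h s hsU)
  simp only [mul_smul] at key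
  rw [hs1 x (.inl hxV), hs2 (φ • x)] at key
  · exact hx (smul_left_cancel φ key)
  · rintro (h' | h')
    · exact (hVs h').1 rfl
    · exact (hVs h').2 rfl

theorem sq_smul_of_mem_centSet {π φ : G} (hπ : π * π = 1) (h : φ ∈ CentSet π) {x : X}
    (hx : π • x ≠ x) : (φ * φ) • x = x := by
  have hc : φ * π = π * φ := h π (mem_involSet X rfl hπ fun x => .inr rfl)
  rw [mul_smul]
  rcases smul_eq_or_of_mem_centSet hπ h hx with h' | h'
  · rw [h', h']
  · rw [h', ← mul_smul, hc, mul_smul, h', smul_smul_self hπ]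

variable (X) in
theorem mem_centSet {π s : G} (hπ : π * π = 1) (h : ∀ x : X, π • x ≠ x → s • x = x) :
    s ∈ CentSet π := fun φ hφ => by
  refine ext_smul (X := X) fun x => ?_
  have e1 : ∀ y : X, φ • π • y = π • φ • y := fun y => by rw [← mul_smul, hφ.1, mul_smul]
  rw [mul_smul, mul_smul]
  have hfix : ∀ y : X, π • y = y → φ • y = y := fun y hy => by
    rcases smul_eq_or_of_mem_involSet hπ hφ y with h' | h'
    · exact h'
    · rw [h', hy]
  by_cases hx : π • x = x
  · rw [hfix x hx, hfix]
    by_contra hne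
    have := smul_left_cancel s (h _ hne)
    rw [this] at hne
    exact hne hx
  · rw [h x hx, h]
    intro h'
    rw [← e1] at h'
    exact hx (smul_left_cancel φ h')

theorem mem_suppSet_iff {π g : G} (hπ : π * π = 1) :
    g ∈ SuppSet π ↔ ∀ x : X, π • x = x → g • x = x := by
  constructor
  · intro h x hx
    by_contra hg
    obtain ⟨A, hA, hAd⟩ := eventually_separated (Ample.cont g) hg
    obtain ⟨s, hsx, hs⟩ := exists_small_order G (inter_mem hA ((Ample.invol π hπ).mem_nhds hx))
    have hsV : s ∈ CentSet π := mem_centSet X hπ fun y hy => hs y fun h' => hy h'.2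
    have key := congrArg (· • x) (h s hsV)
    simp only [mul_smul] at key
    have hgx : s • g • x = g • x := hs _ fun h' => hAd x (mem_of_mem_nhds hA) h'.1
    rw [hgx, hgx] at key
    exact hsx (smul_left_cancel g key)
  · intro h φ hφ
    refine ext_smul (X := X) fun x => ?_
    rw [mul_smul, mul_smul _ g]
    by_cases hx : π • x = x
    · rw [h x hx, h]
      by_contra hne
      have := smul_left_cancel (φ * φ) (sq_smul_of_mem_centSet hπ hφ hne)
      rw [this] at hne
      exact hne hx
    · rw [sq_smul_of_mem_centSet hπ hφ hx, sq_smul_of_mem_centSet hπ hφ]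
      intro h'
      have h2 := h _ h'
      have := smul_left_cancel g h2
      rw [this] at h'
      exact hx h'

end Support

section Reconstruction

variable {G X G' X' : Type*} [Group G] [MulAction G X] [TopologicalSpace X] [CompactSpace X]
  [T2Space X] [TotallyDisconnectedSpace X] [Ample G X] [Group G'] [MulAction G' X']
  [TopologicalSpace X'] [CompactSpace X'] [T2Space X'] [TotallyDisconnectedSpace X'] [Ample G' X']

theorem map_support (Φ : G ≃* G') {π g : G} (hπ : π * π = 1) :
    (∀ y : X', Φ π • y = y → Φ g • y = y) ↔ ∀ x : X, π • x = x → g • x = x := by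
  rw [← mem_suppSet_iff hπ, ← mem_suppSet_iff (by rw [← map_mul, hπ, map_one]),
    map_mem_suppSet_iff]

/-- Points are related when they lie in the supports of corresponding involutions. -/
def Rel (Φ : G ≃* G') (x : X) (y : X') : Prop :=
  ∀ π : G, π * π = 1 → (π • x ≠ x ↔ Φ π • y ≠ y)

theorem Rel.symm {Φ : G ≃* G'} {x : X} {y : X'} (h : Rel Φ x y) : Rel Φ.symm y x := fun π hπ => by
  have := h (Φ.symm π) (by rw [← map_mul, hπ, map_one])
  rw [Φ.apply_symm_apply] at this
  exact this.symm

theorem isOpen_smul_ne (g : G) : IsOpen {x : X | g • x ≠ x} :=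
  (isClosed_eq (Ample.cont g) continuous_id).isOpen_compl

theorem exists_rel (Φ : G ≃* G') (x : X) : ∃ y : X', Rel Φ x y := by
  let ι := {π : G // π * π = 1 ∧ π • x ≠ x}
  let K : ι → Set X' := fun π => {y | Φ π.1 • y ≠ y}
  have hK : ∀ π, IsClosed (K π) := fun π =>
    (Ample.invol (Φ π.1) (by rw [← map_mul, π.2.1, map_one])).isClosed_compl
  have hne : ∀ π, (K π).Nonempty := fun π => by
    by_contra h
    have : Φ π.1 = 1 := Ample.faithful (X := X') _ fun y => by
      by_contra hy
      exact h ⟨y, hy⟩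
    rw [map_eq_one_iff _ Φ.injective] at this
    exact π.2.2 (by rw [this, one_smul])
  have hd : Directed (fun s t => t ⊆ s) K := fun π₁ π₂ => by
    obtain ⟨σ, hσ, hσx, hσs⟩ := exists_small_involution G (inter_mem
      ((isOpen_smul_ne π₁.1).mem_nhds π₁.2.2) ((isOpen_smul_ne π₂.1).mem_nhds π₂.2.2))
    refine ⟨⟨σ, hσ, hσx⟩, fun y hy hy' => hy ?_, fun y hy hy' => hy ?_⟩
    · exact (map_support (X := X) Φ π₁.2.1).2 (fun z hz => hσs z fun h => h.1 hz) y hy'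
    · exact (map_support (X := X) Φ π₂.2.1).2 (fun z hz => hσs z fun h => h.2 hz) y hy'
  obtain ⟨σ, hσ, hσx, -⟩ := exists_small_involution G (univ_mem : univ ∈ 𝓝 x)
  have : Nonempty ι := ⟨⟨σ, hσ, hσx⟩⟩
  obtain ⟨y, hy⟩ := IsCompact.nonempty_iInter_of_directed_nonempty_isCompact_isClosed K hd hne
    (fun π => (hK π).isCompact) hK
  have hy' : ∀ π : G, π * π = 1 → π • x ≠ x → Φ π • y ≠ y := fun π h1 h2 =>
    mem_iInter.1 hy ⟨π, h1, h2⟩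
  refine ⟨y, fun π hπ => ⟨hy' π hπ, fun hπy hπx => ?_⟩⟩
  obtain ⟨σ, hσ, hσx, hσs⟩ := exists_small_involution G ((Ample.invol π hπ).mem_nhds hπx)
  obtain ⟨τ, hτ, hτy, hτs⟩ := exists_small_involution G' (inter_mem
    ((isOpen_smul_ne (Φ σ)).mem_nhds (hy' σ hσ hσx)) ((isOpen_smul_ne (Φ π)).mem_nhds hπy))
  have h1 := (map_support (X := X') (X' := X) Φ.symm (π := Φ σ) (g := τ)
    (by rw [← map_mul, hσ, map_one])).2 fun z hz => hτs z fun h => h.1 hz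
  have h2 := (map_support (X := X') (X' := X) Φ.symm (π := Φ π) (g := τ)
    (by rw [← map_mul, hπ, map_one])).2 fun z hz => hτs z fun h => h.2 hz
  rw [Φ.symm_apply_apply] at h1 h2
  have h3 : Φ.symm τ = 1 := Ample.faithful (X := X) _ fun z => by
    by_cases hz : π • z = z
    · exact h2 z hz
    · exact h1 z (hσs z hz)
  rw [map_eq_one_iff _ Φ.symm.injective] at h3
  exact hτy (by rw [h3, one_smul])

theorem Rel.unique {Φ : G ≃* G'} {x : X} {y y' : X'} (h : Rel Φ x y) (h' : Rel Φ x y') :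
    y = y' := by
  by_contra hne
  obtain ⟨σ, hσ, hσy, hσs⟩ := exists_small_involution G'
    (isOpen_compl_singleton.mem_nhds (show y ∈ {y'}ᶜ from hne))
  exact (h'.symm σ hσ).2 ((h.symm σ hσ).1 hσy) (hσs y' fun h => h rfl)

theorem Rel.smul {Φ : G ≃* G'} {x : X} {y : X'} (h : Rel Φ x y) (g : G) :
    Rel Φ (g • x) (Φ g • y) := fun π hπ => by
  have := h (g⁻¹ * π * g) (by
    calc g⁻¹ * π * g * (g⁻¹ * π * g) = g⁻¹ * (π * π) * g := by group
      _ = 1 := by rw [hπ]; group)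
  simpa only [map_mul, map_inv, mul_smul, ne_eq, inv_smul_eq_iff] using this

/-- An isomorphism of ample groups is induced by a homeomorphism. -/
theorem exists_homeomorph (Φ : G ≃* G') :
    ∃ h : X ≃ₜ X', ∀ (g : G) (x : X), h (g • x) = Φ g • h x := by
  choose f hf using exists_rel (X := X) (X' := X') Φ
  choose f' hf' using exists_rel (X := X') (X' := X) Φ.symm
  let e : X ≃ X' := ⟨f, f', fun x => (hf' (f x)).unique (hf x).symm,
    fun y => (hf (f' y)).unique (hf' y).symm⟩
  have he : Continuous e := by
    refine continuous_iff_continuousAt.2 fun x U hU => ?_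
    obtain ⟨σ, hσ, hσy, hσs⟩ := exists_small_involution G' hU
    change e ⁻¹' U ∈ 𝓝 x
    filter_upwards [(isOpen_smul_ne (Φ.symm σ)).mem_nhds (((hf x).symm σ hσ).1 hσy)] with z hz
    exact mem_of_smul_ne hσs (((hf z).symm σ hσ).2 hz)
  exact ⟨he.homeoOfEquivCompactToT2, fun g x => (hf (g • x)).unique ((hf x).smul g)⟩

end Reconstruction

end Rubin

namespace NV

open Set Topology Filter

section Decompositions

variable {n k r r' : ℕ}

/-- The boxes of the charts `c t` partition `A`. -/
def IsDec {ι : Type*} (A : Set (Y n k r)) (c : ι → Chart n k r) : Prop :=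
  (∀ t, range (app (c t)) ⊆ A) ∧ ∀ y ∈ A, ∃! t, y ∈ range (app (c t))

/-- The set `A` can be partitioned into `p` boxes. -/
def Dec (A : Set (Y n k r)) (p : ℕ) : Prop := ∃ c : Fin p → Chart n k r, IsDec A c

theorem IsDec.dec {ι : Type*} [Fintype ι] {A : Set (Y n k r)} {c : ι → Chart n k r}
    (h : IsDec A c) : Dec A (Fintype.card ι) := by
  refine ⟨c ∘ (Fintype.equivFin ι).symm, fun t => h.1 _, fun y hy => ?_⟩
  obtain ⟨t, ht, hu⟩ := h.2 y hy
  refine ⟨Fintype.equivFin ι t, by simpa using ht, fun s hs => ?_⟩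
  rw [← hu _ hs, Equiv.apply_symm_apply]

theorem IsDec.sigma {ι : Type*} {κ : ι → Type*} {A : Set (Y n k r)} {B : ι → Set (Y n k r)}
    (hB : ∀ t, B t ⊆ A) (hu : ∀ y ∈ A, ∃! t, y ∈ B t) {c : ∀ t, κ t → Chart n k r}
    (h : ∀ t, IsDec (B t) (c t)) : IsDec A fun s : Σ t, κ t => c s.1 s.2 := by
  refine ⟨fun s => ((h s.1).1 s.2).trans (hB _), fun y hy => ?_⟩
  obtain ⟨t, ht, htu⟩ := hu y hy
  obtain ⟨s, hs, hsu⟩ := (h t).2 y ht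
  refine ⟨⟨t, s⟩, hs, ?_⟩
  rintro ⟨t', s'⟩ h'
  obtain rfl := htu t' ((h t').1 s' h')
  rw [hsu s' h']

theorem Dec.sum {ι : Type*} [Fintype ι] {A : Set (Y n k r)} {B : ι → Set (Y n k r)} {p : ι → ℕ}
    (hB : ∀ t, B t ⊆ A) (hu : ∀ y ∈ A, ∃! t, y ∈ B t) (h : ∀ t, Dec (B t) (p t)) :
    Dec A (∑ t, p t) := by
  choose c hc using h
  simpa using (IsDec.sigma hB hu hc).dec

theorem IsDec.sum_elim {ι κ : Type*} {A : Set (Y n k r)} {c : ι → Chart n k r}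
    {d : κ → Chart n k r} (hc : IsDec A c) (hd : IsDec Aᶜ d) : IsDec univ (Sum.elim c d) := by
  refine ⟨fun t => subset_univ _, fun y _ => ?_⟩
  by_cases hy : y ∈ A
  · obtain ⟨t, ht, hu⟩ := hc.2 y hy
    refine ⟨.inl t, ht, ?_⟩
    rintro (s | s) hs
    · rw [hu s hs]
    · exact absurd hy (hd.1 s hs)
  · obtain ⟨t, ht, hu⟩ := hd.2 y hy
    refine ⟨.inr t, ht, ?_⟩
    rintro (s | s) hs
    · exact absurd (hc.1 s hs) hy
    · rw [hu s hs]

theorem dec_range_app (c : Chart n k r) : Dec (range (app c)) 1 :=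
  ⟨fun _ => c, fun _ => subset_rfl, fun _ hy => ⟨0, hy, fun _ _ => Subsingleton.elim _ _⟩⟩

theorem isDec_cells {N : ℕ} {A : Set (Y n k r)}
    (hA : ∀ w : Cell n k r N, range (app (cell w)) ⊆ A ∨ range (app (cell w)) ⊆ Aᶜ) :
    IsDec A fun w : {w : Cell n k r N // range (app (cell w)) ⊆ A} => cell w.1 := by
  refine ⟨fun w => w.2, fun y hy => ⟨⟨code N y, ?_⟩, ⟨_, app_cell_code N y⟩, ?_⟩⟩
  · exact (hA _).resolve_right fun h => h ⟨_, app_cell_code N y⟩ hy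
  · rintro ⟨w, hw⟩ h
    exact Subtype.ext (mem_range_cell.1 h).symm

theorem exists_chart_subset {y : Y n k r} {U : Set (Y n k r)} (hU : U ∈ 𝓝 y) :
    ∃ c, y ∈ range (app c) ∧ range (app c) ⊆ U := by
  obtain ⟨N, hN⟩ := exists_cell_subset hU
  exact ⟨_, ⟨_, app_cell_code N y⟩, hN N le_rfl⟩

theorem Loc.exists_dec_image [NeZero k] {f : Y n k r ≃ Y n k r'} (hf : Loc f)
    {A : Set (Y n k r)} (hA : IsClopen A) : ∃ p, Dec A p ∧ Dec (f '' A) p := by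
  classical
  obtain ⟨N, hN⟩ := exists_depth (n := n) (k := k) (r := r)
    (Q := fun c => (∃ d, ∀ x', f (app c x') = app d x') ∧
      (range (app c) ⊆ A ∨ range (app c) ⊆ Aᶜ))
    (fun c t h => ⟨Loc.hereditary t h.1, h.2.imp (range_app_ext c t).trans (range_app_ext c t).trans⟩)
    fun y => by
      obtain ⟨c, d, x, rfl, hd⟩ := hf y
      have : ∃ c', app c x ∈ range (app c') ∧ (range (app c') ⊆ A ∨ range (app c') ⊆ Aᶜ) := by
        by_cases hy : app c x ∈ A
        · obtain ⟨c', h1, h2⟩ := exists_chart_subset (hA.isOpen.mem_nhds hy)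
          exact ⟨c', h1, .inl h2⟩
        · obtain ⟨c', h1, h2⟩ := exists_chart_subset (hA.compl.isOpen.mem_nhds hy)
          exact ⟨c', h1, .inr h2⟩
      obtain ⟨c', ⟨z, hz⟩, h⟩ := this
      obtain ⟨s, t, x', hst, hx, -⟩ := exists_ext_eq_ext hz.symm
      refine ⟨ext c s, ⟨x', ?_⟩, Loc.hereditary s ⟨d, hd⟩, ?_⟩
      · rw [app_ext, hx]
      · rw [hst]
        exact h.imp (range_app_ext c' t).trans (range_app_ext c' t).trans
  choose hd h using hN
  choose d hd using hd
  have hdec := isDec_cells h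
  refine ⟨_, hdec.dec, IsDec.dec (c := fun w : {w : Cell n k r N // range (app (cell w)) ⊆ A} =>
    d w.1) ⟨?_, ?_⟩⟩
  · rintro w _ ⟨x, rfl⟩
    exact ⟨_, w.2 ⟨x, rfl⟩, hd w.1 x⟩
  · rintro _ ⟨y, hy, rfl⟩
    obtain ⟨w, ⟨x, hx⟩, hu⟩ := hdec.2 y hy
    refine ⟨w, ⟨x, by rw [← hx]; exact (hd _ _).symm⟩, ?_⟩
    rintro w' ⟨x', hx'⟩
    rw [← hd] at hx'
    exact hu w' ⟨x', f.injective hx'⟩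

theorem exists_dec [NeZero k] {A : Set (Y n k r)} (hA : IsClopen A) : ∃ p, Dec A p := by
  obtain ⟨p, hp, -⟩ := (Loc.id (n := n) (k := k) (r := r)).exists_dec_image
    (f := Equiv.refl _) hA
  exact ⟨p, hp⟩

theorem dec_univ : Dec (univ : Set (Y n k r)) r := by
  refine ⟨fun t => (fun _ => [], t), fun t => subset_univ _, fun y _ => ⟨y.2, ?_, fun t ht => ?_⟩⟩
  · exact mem_range_app.2 ⟨rfl, fun i j h => absurd h (by simp)⟩
  · exact (mem_range_app.1 ht).1.symm

/-- Lengthening the word of `c` at one coordinate by one letter. -/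
def snoc (c : Chart n k r) (i : Fin n) (j : Fin k) : Chart n k r :=
  ext c (Function.update (fun _ => []) i [j])

theorem app_mem_range_snoc {c : Chart n k r} {i : Fin n} {j : Fin k} {x : Fin n → Cantor k} :
    app c x ∈ range (app (snoc c i j)) ↔ x i 0 = j := by
  constructor
  · rintro ⟨z, hz⟩
    rw [snoc, app_ext] at hz
    rw [← app_injective c hz]
    simp [concat]
  · rintro rfl
    refine ⟨Function.update x i fun m => x i (m + 1), ?_⟩
    rw [snoc, app_ext]
    congr 1
    funext i'
    by_cases h : i' = i
    · subst h
      funext m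
      cases m <;> simp [concat]
    · simp [h, concat_nil]

theorem dec_split (c : Chart n k r) (i : Fin n) : Dec (range (app c)) k := by
  refine ⟨snoc c i, fun t => range_app_ext _ _, ?_⟩
  rintro _ ⟨x, rfl⟩
  exact ⟨x i 0, app_mem_range_snoc.2 rfl, fun t ht => (app_mem_range_snoc.1 ht).symm⟩

theorem Dec.add_pred [NeZero k] (hn : 1 ≤ n) {A : Set (Y n k r)} {p : ℕ} (hp : 1 ≤ p)
    (h : Dec A p) : Dec A (p + (k - 1)) := by
  obtain ⟨c, hc⟩ := h
  have := Dec.sum (p := fun t : Fin p => if t = ⟨0, hp⟩ then k else 1) hc.1 hc.2 fun t => by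
    split_ifs
    · exact dec_split _ ⟨0, hn⟩
    · exact dec_range_app _
  convert this using 1
  have hk := NeZero.one_le (n := k)
  rw [Finset.sum_congr rfl (g := fun t : Fin p => 1 + if t = ⟨0, hp⟩ then k - 1 else 0)]
  · rw [Finset.sum_add_distrib]
    simp
  · intro t _
    split_ifs <;> omega

theorem Dec.add_mul_pred [NeZero k] (hn : 1 ≤ n) {A : Set (Y n k r)} {p : ℕ} (hp : 1 ≤ p)
    (h : Dec A p) (j : ℕ) : Dec A (p + j * (k - 1)) := by
  induction j with
  | zero => simpa using h
  | succ j ih =>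
    have := ih.add_pred hn (by omega)
    rwa [add_assoc, ← Nat.succ_mul] at this

theorem natCast_self_pred [NeZero k] : (k : ZMod (k - 1)) = 1 := by
  have hk := NeZero.one_le (n := k)
  have h : ((k - 1 + 1 : ℕ) : ZMod (k - 1)) = 1 := by
    rw [Nat.cast_add, ZMod.natCast_self, zero_add, Nat.cast_one]
  rwa [Nat.sub_add_cancel hk] at h

open Classical in
theorem card_cells_range_app [NeZero k] {N : ℕ} {c : Chart n k r} (hN : ∀ i, (c.1 i).length ≤ N) :
    ((Finset.univ.filter fun w : Cell n k r N =>
      app (cell w) (fun _ _ => 0) ∈ range (app c)).card : ZMod (k - 1)) = 1 := by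
  have : (Finset.univ.filter fun w : Cell n k r N =>
      app (cell w) (fun _ _ => 0) ∈ range (app c)) =
      (Fintype.piFinset fun i => Fintype.piFinset fun j : Fin N =>
        if h : (j : ℕ) < (c.1 i).length then {(c.1 i)[(j : ℕ)]} else Finset.univ) ×ˢ {c.2} := by
    ext w
    simp only [Finset.mem_filter, Finset.mem_univ, true_and, Finset.mem_product,
      Fintype.mem_piFinset, Finset.mem_singleton, mem_range_app]
    rw [and_comm]
    refine and_congr ⟨fun h i j => ?_, fun h i j hj => ?_⟩ Iff.rfl
    · split_ifs with hj
      · rw [Finset.mem_singleton, ← h i j hj]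
        exact (concat_ofFn (w.1 i) (fun _ => 0) j).symm
      · exact Finset.mem_univ _
    · have := h i ⟨j, hj.trans_le (hN i)⟩
      rw [dif_pos hj, Finset.mem_singleton] at this
      rw [← this]
      exact concat_ofFn (w.1 i) (fun _ => 0) ⟨j, hj.trans_le (hN i)⟩
  rw [this, Finset.card_product, Fintype.card_piFinset]
  simp only [Fintype.card_piFinset, Finset.card_singleton, mul_one, Nat.cast_prod]
  refine Finset.prod_eq_one fun i _ => Finset.prod_eq_one fun j _ => ?_
  split_ifs
  · simp
  · rw [Finset.card_univ, Fintype.card_fin, natCast_self_pred]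

open Classical in
theorem IsDec.card_cells [NeZero k] {p N : ℕ} {A : Set (Y n k r)} {c : Fin p → Chart n k r}
    (h : IsDec A c) (hN : ∀ t i, ((c t).1 i).length ≤ N) :
    ((Finset.univ.filter fun w : Cell n k r N =>
      app (cell w) (fun _ _ => 0) ∈ A).card : ZMod (k - 1)) = p := by
  have : (Finset.univ.filter fun w : Cell n k r N => app (cell w) (fun _ _ => 0) ∈ A) =
      Finset.univ.biUnion fun t => Finset.univ.filter fun w : Cell n k r N =>
        app (cell w) (fun _ _ => 0) ∈ range (app (c t)) := by
    ext w
    simp only [Finset.mem_filter, Finset.mem_univ, true_and, Finset.mem_biUnion]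
    exact ⟨fun hw => (h.2 _ hw).exists, fun ⟨t, ht⟩ => h.1 t ht⟩
  rw [this, Finset.card_biUnion, Nat.cast_sum, Finset.sum_congr rfl fun t _ =>
    card_cells_range_app (hN t)]
  · simp
  · intro s _ t _ hst
    refine Finset.disjoint_left.2 fun w hs ht => hst ?_
    simp only [Finset.mem_filter, Finset.mem_univ, true_and] at hs ht
    exact (h.2 _ (h.1 s hs)).unique hs ht

/-- The number of boxes in a decomposition is determined modulo `k - 1`. -/
theorem Dec.natCast_eq [NeZero k] {A : Set (Y n k r)} {p q : ℕ} (hp : Dec A p) (hq : Dec A q) :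
    (p : ZMod (k - 1)) = q := by
  obtain ⟨c, hc⟩ := hp
  obtain ⟨d, hd⟩ := hq
  choose M hM using fun t => exists_length_le (c t)
  choose M' hM' using fun t => exists_length_le (d t)
  have h1 : ∀ t, M t ≤ Finset.univ.sup M ⊔ Finset.univ.sup M' := fun t =>
    (Finset.le_sup (Finset.mem_univ t)).trans le_sup_left
  have h2 : ∀ t, M' t ≤ Finset.univ.sup M ⊔ Finset.univ.sup M' := fun t =>
    (Finset.le_sup (Finset.mem_univ t)).trans le_sup_right
  rw [← hc.card_cells fun t i => (hM t i).trans (h1 t),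
    ← hd.card_cells fun t i => (hM' t i).trans (h2 t)]

theorem IsDec.bijective {ι : Type*} {c : ι → Chart n k r} (h : IsDec univ c) :
    Function.Bijective fun s : ι × (Fin n → Cantor k) => app (c s.1) s.2 := by
  refine ⟨fun ⟨s, x⟩ ⟨t, z⟩ e => ?_, fun y => ?_⟩
  · have : s = t := (h.2 _ (mem_univ _)).unique ⟨x, rfl⟩ ⟨z, e.symm⟩
    subst this
    exact congrArg (Prod.mk s) (app_injective _ e)
  · obtain ⟨t, ⟨x, hx⟩, -⟩ := h.2 y (mem_univ y)
    exact ⟨(t, x), hx⟩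

theorem exists_equiv_of_isDec {ι : Type*} {c : ι → Chart n k r} {d : ι → Chart n k r'}
    (hc : IsDec univ c) (hd : IsDec univ d) :
    ∃ e : Y n k r ≃ Y n k r', Loc e ∧ ∀ t x, e (app (c t) x) = app (d t) x := by
  let e := (Equiv.ofBijective _ hc.bijective).symm.trans (Equiv.ofBijective _ hd.bijective)
  have he : ∀ t x, e (app (c t) x) = app (d t) x := fun t x => by
    have : (Equiv.ofBijective _ hc.bijective).symm (app (c t) x) = (t, x) := by
      rw [Equiv.symm_apply_eq]; rfl
    simp only [e, Equiv.trans_apply, this]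
    rfl
  refine ⟨e, fun y => ?_, he⟩
  obtain ⟨t, ⟨x, hx⟩, -⟩ := hc.2 y (mem_univ y)
  exact ⟨c t, d t, x, hx.symm, he t⟩

theorem exists_loc_image_eq {A B : Set (Y n k r)} {p q : ℕ} (hA : Dec A p) (hB : Dec B p)
    (hA' : Dec Aᶜ q) (hB' : Dec Bᶜ q) : ∃ e : Equiv.Perm (Y n k r), Loc e ∧ e '' A = B := by
  obtain ⟨a, ha⟩ := hA
  obtain ⟨b, hb⟩ := hB
  obtain ⟨a', ha'⟩ := hA'
  obtain ⟨b', hb'⟩ := hB'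
  obtain ⟨e, he, h⟩ := exists_equiv_of_isDec (ha.sum_elim ha') (hb.sum_elim hb')
  refine ⟨e, he, Subset.antisymm ?_ fun y hy => ?_⟩
  · rintro _ ⟨y, hy, rfl⟩
    obtain ⟨t, ⟨x, rfl⟩, -⟩ := ha.2 y hy
    exact hb.1 t ⟨x, (h (.inl t) x).symm⟩
  · obtain ⟨t, ⟨x, rfl⟩, -⟩ := hb.2 y hy
    exact ⟨app (a t) x, ha.1 t ⟨x, rfl⟩, h (.inl t) x⟩

end Decompositions

end NV

namespace NV

open Set Topology Filter

section Counting

variable {n k r : ℕ}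

theorem Dec.one_le {A : Set (Y n k r)} {p : ℕ} (h : Dec A p) (hA : A.Nonempty) : 1 ≤ p := by
  obtain ⟨c, hc⟩ := h
  obtain ⟨y, hy⟩ := hA
  obtain ⟨t, -⟩ := hc.2 y hy
  exact t.pos

theorem Dec.exists_common [NeZero k] (hn : 1 ≤ n) {A B : Set (Y n k r)} {p q : ℕ} (hA : Dec A p)
    (hB : Dec B q) (hA' : A.Nonempty) (hB' : B.Nonempty) (h : (p : ZMod (k - 1)) = q) :
    ∃ m, Dec A m ∧ Dec B m := by
  wlog hpq : p ≤ q generalizing A B p q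
  · obtain ⟨m, h1, h2⟩ := this hB hA hB' hA' h.symm (le_of_not_ge hpq)
    exact ⟨m, h2, h1⟩
  obtain ⟨j, hj⟩ := (Nat.modEq_iff_dvd' hpq).1 ((ZMod.natCast_eq_natCast_iff _ _ _).1 h)
  refine ⟨q, ?_, hB⟩
  have := hA.add_mul_pred hn (hA.one_le hA') j
  rwa [mul_comm, ← hj, Nat.add_sub_cancel' hpq] at this

theorem Dec.add_compl [NeZero k] {A : Set (Y n k r)} {p q : ℕ} (hA : Dec A p) (hA' : Dec Aᶜ q) :
    (p + q : ZMod (k - 1)) = r := by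
  obtain ⟨a, ha⟩ := hA
  obtain ⟨b, hb⟩ := hA'
  have := (ha.sum_elim hb).dec.natCast_eq dec_univ
  simpa using this

theorem IsDec.isClopen {ι : Type*} [Finite ι] {A : Set (Y n k r)} {c : ι → Chart n k r}
    (h : IsDec A c) : IsClopen A := by
  have : A = ⋃ t, range (app (c t)) :=
    Subset.antisymm (fun y hy => mem_iUnion.2 (h.2 y hy).exists) (iUnion_subset h.1)
  rw [this]
  exact isClopen_iUnion_of_finite fun t => isClopen_range_app _

theorem Dec.isClopen {A : Set (Y n k r)} {p : ℕ} (h : Dec A p) : IsClopen A := by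
  obtain ⟨c, hc⟩ := h
  exact hc.isClopen

/-- Clopen sets with congruent box numbers are equivalent. -/
theorem exists_loc_image_eq_of_natCast_eq [NeZero k] (hn : 1 ≤ n) {A B : Set (Y n k r)} {p q : ℕ}
    (hA : Dec A p) (hB : Dec B q) (h : (p : ZMod (k - 1)) = q) (hA1 : A.Nonempty)
    (hB1 : B.Nonempty) (hA2 : Aᶜ.Nonempty) (hB2 : Bᶜ.Nonempty) :
    ∃ e : Equiv.Perm (Y n k r), Loc e ∧ e '' A = B := by
  obtain ⟨p', hp'⟩ := exists_dec hA.isClopen.compl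
  obtain ⟨q', hq'⟩ := exists_dec hB.isClopen.compl
  have h' : (p' : ZMod (k - 1)) = q' := by
    have := (hA.add_compl hp').trans (hB.add_compl hq').symm
    rwa [h, add_right_inj] at this
  obtain ⟨m, hm1, hm2⟩ := hA.exists_common hn hB hA1 hB1 h
  obtain ⟨m', hm1', hm2'⟩ := hp'.exists_common hn hq' hA2 hB2 h'
  exact exists_loc_image_eq hm1 hm2 hm1' hm2'

theorem exists_loc_app_eq [NeZero k] (hn : 1 ≤ n) {a b : Chart n k r}
    (ha : (range (app a))ᶜ.Nonempty) (hb : (range (app b))ᶜ.Nonempty) :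
    ∃ e : Equiv.Perm (Y n k r), Loc e ∧ ∀ x, e (app a x) = app b x := by
  obtain ⟨p, hp⟩ := exists_dec (isClopen_range_app a).compl
  obtain ⟨q, hq⟩ := exists_dec (isClopen_range_app b).compl
  have h' : (p : ZMod (k - 1)) = q := by
    have := ((dec_range_app a).add_compl hp).trans ((dec_range_app b).add_compl hq).symm
    rwa [add_right_inj] at this
  obtain ⟨m, ⟨c, hc⟩, ⟨d, hd⟩⟩ := hp.exists_common hn hq ha hb h'
  have hs : ∀ c : Chart n k r, IsDec (range (app c)) fun _ : Unit => c := fun c =>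
    ⟨fun _ => subset_rfl, fun _ hy => ⟨(), hy, fun _ _ => rfl⟩⟩
  obtain ⟨e, he, h⟩ := exists_equiv_of_isDec ((hs a).sum_elim hc) ((hs b).sum_elim hd)
  exact ⟨e, he, h (.inl ())⟩

end Counting

section Lag

variable {n k r r' r'' : ℕ}

/-- The map `f` changes the lengths of prefixes near `x` by `l`. -/
def HasLag (f : Y n k r → Y n k r') (x : Y n k r) (l : Fin n → ℤ) : Prop :=
  ∃ (c : Chart n k r) (d : Chart n k r') (z : Fin n → Cantor k), x = app c z ∧
    (∀ z', f (app c z') = app d z') ∧ ∀ i, l i = (d.1 i).length - (c.1 i).length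

theorem Loc.exists_hasLag {f : Y n k r → Y n k r'} (hf : Loc f) (x : Y n k r) :
    ∃ l, HasLag f x l := by
  obtain ⟨c, d, z, h1, h2⟩ := hf x
  exact ⟨_, c, d, z, h1, h2, fun _ => rfl⟩

theorem HasLag.id (x : Y n k r) : HasLag (_root_.id : Y n k r → Y n k r) x 0 := by
  refine ⟨_, _, _, (app_cell_code 0 x).symm, fun _ => rfl, fun i => ?_⟩
  simp

theorem HasLag.refine {f : Y n k r → Y n k r'} {x : Y n k r} {l : Fin n → ℤ} (h : HasLag f x l)
    {b : Chart n k r} (hb : x ∈ range (app b)) : ∃ (t : Fin n → List (Fin k)) (d : Chart n k r')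
      (z : Fin n → Cantor k), x = app (ext b t) z ∧ (∀ z', f (app (ext b t) z') = app d z') ∧
      ∀ i, l i = (d.1 i).length - ((ext b t).1 i).length := by
  obtain ⟨c, d, z, rfl, hd, hl⟩ := h
  obtain ⟨z', hz'⟩ := hb
  obtain ⟨s, t, w, hst, rfl, rfl⟩ := exists_ext_eq_ext hz'.symm
  refine ⟨t, ext d s, w, ?_, fun w' => ?_, fun i => ?_⟩
  · rw [← hst, app_ext]
  · rw [← hst, app_ext, hd, app_ext]
  · rw [hl, ← hst]
    simp [ext]

theorem HasLag.congr {f f' : Y n k r → Y n k r'} {x : Y n k r} {l : Fin n → ℤ} (h : HasLag f x l)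
    (hf : f =ᶠ[𝓝 x] f') : HasLag f' x l := by
  obtain ⟨b, hb, hbU⟩ := exists_chart_subset hf
  obtain ⟨t, d, z, h1, h2, h3⟩ := h.refine hb
  refine ⟨_, d, z, h1, fun z' => ?_, h3⟩
  rw [← h2]
  exact (hbU (range_app_ext b t ⟨z', rfl⟩)).symm

theorem length_eq_of_concat_eq (hk : 2 ≤ k) {u v : List (Fin k)}
    (h : ∀ z, concat u z = concat v z) : u.length = v.length := by
  wlog hl : u.length ≤ v.length generalizing u v
  · exact (this (fun z => (h z).symm) (le_of_not_ge hl)).symm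
  obtain ⟨t, rfl, -⟩ := concat_eq_concat (h fun _ => ⟨0, by omega⟩) hl
  rcases t with _ | ⟨a, t⟩
  · simp
  · exfalso
    have key : ∀ z : Cantor k, z 0 = a := fun z => by
      have := h z
      rw [concat_append] at this
      rw [concat_injective u this]
      simp [concat]
    have := (key fun _ => ⟨0, by omega⟩).trans (key fun _ => ⟨1, by omega⟩).symm
    simp at this

theorem HasLag.unique (hk : 2 ≤ k) {f : Y n k r → Y n k r'} {x : Y n k r} {l l' : Fin n → ℤ}
    (h : HasLag f x l) (h' : HasLag f x l') : l = l' := by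
  obtain ⟨c, d, z, rfl, hd, hl⟩ := h
  obtain ⟨t, d', z', h1, h2, h3⟩ := h'.refine ⟨z, rfl⟩
  funext i
  have : (d'.1 i).length = (d.1 i ++ t i).length := by
    refine length_eq_of_concat_eq hk fun w => ?_
    have e := (h2 fun _ => w).symm
    rw [app_ext, hd, ← app_ext] at e
    exact congrFun (congrArg Prod.fst e) i
  rw [hl, h3, this]
  simp [ext]

theorem HasLag.comp {f : Y n k r → Y n k r'} {g : Y n k r' → Y n k r''} {x : Y n k r}
    {l l' : Fin n → ℤ} (h' : HasLag g (f x) l') (h : HasLag f x l) :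
    HasLag (g ∘ f) x (l' + l) := by
  obtain ⟨c, d, z, rfl, hd, hl⟩ := h
  obtain ⟨t, d', z', h1, h2, h3⟩ := h'.refine (b := d) ⟨z, (hd z).symm⟩
  refine ⟨ext c t, d', z', ?_, fun w => ?_, fun i => ?_⟩
  · rw [hd, app_ext] at h1
    rw [app_ext, app_injective d h1]
  · rw [Function.comp_apply, app_ext, hd, ← app_ext, h2]
  · rw [Pi.add_apply, hl, h3]
    simp [ext]
    ring

theorem HasLag.symm {e : Y n k r ≃ Y n k r'} {x : Y n k r} {l : Fin n → ℤ} (h : HasLag e x l) :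
    HasLag e.symm (e x) (-l) := by
  obtain ⟨c, d, z, rfl, hd, hl⟩ := h
  refine ⟨d, c, z, hd z, fun w => ?_, fun i => ?_⟩
  · rw [← hd, Equiv.symm_apply_apply]
  · rw [Pi.neg_apply, hl]; ring

theorem HasLag.eventually_eq {f : Y n k r → Y n k r} {x : Y n k r} (h : HasLag f x 0)
    (hx : f x = x) : ∀ᶠ y in 𝓝 x, f y = y := by
  obtain ⟨c, d, z, rfl, hd, hl⟩ := h
  have hdc : d = c := by
    rw [hd] at hx
    refine Prod.ext (funext fun i => ?_) (congrArg Prod.snd hx :)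
    have hi : concat (d.1 i) (z i) = concat (c.1 i) (z i) := congrFun (congrArg Prod.fst hx) i
    have hli := hl i
    simp only [Pi.zero_apply] at hli
    obtain ⟨t, ht, -⟩ := concat_eq_concat hi (by omega)
    have : t = [] := List.eq_nil_of_length_eq_zero (by
      have := congrArg List.length ht
      rw [List.length_append] at this
      omega)
    rw [ht, this, List.append_nil]
  filter_upwards [(isOpen_range_app c).mem_nhds ⟨z, rfl⟩]
  rintro _ ⟨w, rfl⟩
  rw [hd, hdc]

/-- The stabilizer of `x`, with lags. -/
def lagGroup (x : Y n k r) : Subgroup (Equiv.Perm (Y n k r) × Multiplicative (Fin n → ℤ)) where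
  carrier := {p | p.1 x = x ∧ HasLag p.1 x p.2.toAdd}
  mul_mem' := by
    rintro ⟨g, l⟩ ⟨h, m⟩ ⟨h1, h2⟩ ⟨h3, h4⟩
    refine ⟨?_, HasLag.comp (g := g) (f := h) ?_ h4⟩
    · change g (h x) = x
      rw [show h x = x from h3]; exact h1
    · rw [show h x = x from h3]; exact h2
  one_mem' := ⟨rfl, HasLag.id x⟩
  inv_mem' := by
    rintro ⟨g, l⟩ ⟨h1, h2⟩
    refine ⟨?_, ?_⟩
    · change g.symm x = x
      rw [Equiv.symm_apply_eq]; exact h1.symm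
    · have := HasLag.symm h2
      rw [show g x = x from h1] at this
      exact this

theorem snd_listProd_ofFn {N : ℕ} (l : Fin N → Fin n → ℤ) (g : Fin N → Equiv.Perm (Y n k r))
    (e : Fin N → ℤ) :
    (List.ofFn fun i => ((g i, Multiplicative.ofAdd (l i)) : _ × _) ^ e i).prod =
      ((List.ofFn fun i => g i ^ e i).prod, Multiplicative.ofAdd (∑ i, e i • l i)) := by
  refine Prod.ext ?_ ?_
  · rw [← MonoidHom.coe_fst, map_list_prod, List.map_ofFn]
    rfl
  · rw [← MonoidHom.coe_snd, map_list_prod, List.map_ofFn, List.prod_ofFn, ofAdd_sum]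
    rfl

end Lag

end NV

namespace NV

open Set Topology Filter

section Ample

variable {n k r : ℕ}

theorem loc_of_eventuallyEq {r' : ℕ} {f : Y n k r → Y n k r'}
    (h : ∀ x, ∃ g : Y n k r → Y n k r', Loc g ∧ f =ᶠ[𝓝 x] g) : Loc f := fun x => by
  obtain ⟨g, hg, hfg⟩ := h x
  obtain ⟨l, hl⟩ := hg.exists_hasLag x
  obtain ⟨c, d, z, h1, h2, -⟩ := hl.congr hfg.symm
  exact ⟨c, d, z, h1, h2⟩

theorem ample (hn : 1 ≤ n) (hk : 2 ≤ k) {G : Subgroup (Equiv.Perm (Y n k r))}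
    (hG : ∀ g, g ∈ G ↔ Loc g) : Rubin.Ample G (Y n k r) where
  cont g := ((hG _).1 g.2).continuous
  faithful g h := Subtype.ext (Equiv.ext h)
  full γ h := ⟨⟨γ, (hG γ).2 (loc_of_eventuallyEq fun x => by
    obtain ⟨g, hg⟩ := h x
    exact ⟨g, (hG _).1 g.2, hg⟩)⟩, fun _ => rfl⟩
  rich x U hU := by
    have : NeZero k := ⟨by omega⟩
    obtain ⟨N, hN⟩ := exists_cell_subset hU
    obtain ⟨j, hj⟩ : ∃ j : Fin k, j ≠ x.1 ⟨0, hn⟩ N := by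
      have : Nontrivial (Fin k) := Fin.nontrivial_iff_two_le.2 hk
      exact exists_ne _
    let x' : Y n k r := (Function.update x.1 ⟨0, hn⟩ (Function.update (x.1 ⟨0, hn⟩) N j), x.2)
    have hne : code (N + 1) x' ≠ code (N + 1) x := fun h => by
      have := congrFun (congrFun (congrArg Prod.fst h) ⟨0, hn⟩) (Fin.last N)
      simp [code, x', hj] at this
    have hx' : code N x' = code N x := by
      refine Prod.ext (funext fun i => funext fun m => ?_) rfl
      by_cases hi : i = ⟨0, hn⟩
      · subst hi
        simp [code, x', m.2.ne]
      · simp [code, x', hi]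
    obtain ⟨e, he, h⟩ := exists_loc_app_eq hn (a := cell (code (N + 1) x))
      (b := cell (code (N + 1) x')) ⟨x', fun h => hne (mem_range_cell.1 h)⟩
      ⟨x, fun h => hne (mem_range_cell.1 h).symm⟩
    have hex : e x ∈ range (app (cell (code (N + 1) x'))) :=
      ⟨_, by rw [← h, app_cell_code]⟩
    refine ⟨⟨e, (hG e).2 he⟩, hN N le_rfl (mem_range_cell.2 ?_), fun h' => hne ?_⟩
    · change code N (e x) = code N x
      rw [← hx']
      have := mem_range_cell.1 hex
      refine Prod.ext (funext fun i => funext fun m => ?_) (congrArg Prod.snd this :)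
      exact congrFun (congrFun (congrArg Prod.fst this) i) m.castSucc
    · rw [← mem_range_cell.1 hex]
      exact congrArg _ h'
  invol g h := by
    refine isOpen_iff_mem_nhds.2 fun x hx => ?_
    obtain ⟨l, hl⟩ := ((hG _).1 g.2).exists_hasLag x
    have hx' : (g : Equiv.Perm (Y n k r)) x = x := hx
    have h2 := HasLag.comp (g := (g : Equiv.Perm (Y n k r))) (by rw [hx']; exact hl) hl
    have hid : (g : Equiv.Perm (Y n k r)) ∘ (g : Equiv.Perm (Y n k r)) = id :=
      funext fun y => Rubin.smul_smul_self h y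
    rw [hid] at h2
    have h0 := h2.unique hk (HasLag.id x)
    have : l = 0 := by
      funext i
      have := congrFun h0 i
      simp only [Pi.add_apply, Pi.zero_apply] at this ⊢
      omega
    subst this
    exact hl.eventually_eq hx'

end Ample

/-- The bijection `h` conjugates the two Thompson groups into each other. -/
def Conj {n k r n' k' r' : ℕ} (h : Y n k r ≃ Y n' k' r') : Prop :=
  ∀ e : Equiv.Perm (Y n k r), Loc e ↔ Loc (h.permCongr e)

section Conj

variable {n k r n' k' r' n'' k'' r'' : ℕ}

theorem Conj.symm {h : Y n k r ≃ Y n' k' r'} (hh : Conj h) : Conj h.symm := fun e => by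
  rw [hh (h.symm.permCongr e)]
  have : h.permCongr (h.symm.permCongr e) = e := by ext1 y; simp [Equiv.permCongr_apply]
  rw [this]

theorem Conj.trans {h : Y n k r ≃ Y n' k' r'} {h' : Y n' k' r' ≃ Y n'' k'' r''} (hh : Conj h)
    (hh' : Conj h') : Conj (h.trans h') := fun e => by
  rw [hh e, hh' (h.permCongr e)]
  rfl

theorem Loc.conj {h : Y n k r ≃ Y n k r'} (hh : Loc h) : Conj h := fun e => by
  refine ⟨fun he => (hh.comp he).comp hh.symm, fun he => ?_⟩
  have := (hh.symm.comp he).comp hh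
  convert this
  funext y
  simp [Equiv.permCongr_apply]

theorem Conj.nonempty_mulEquiv {h : Y n k r ≃ Y n' k' r'} (hh : Conj h)
    {G : Subgroup (Equiv.Perm (Y n k r))} {G' : Subgroup (Equiv.Perm (Y n' k' r'))}
    (hG : ∀ g, g ∈ G ↔ Loc g) (hG' : ∀ g, g ∈ G' ↔ Loc g) : Nonempty (G ≃* G') :=
  ⟨{ toFun := fun g => ⟨h.permCongr g, (hG' _).2 ((hh _).1 ((hG _).1 g.2))⟩
     invFun := fun g => ⟨h.symm.permCongr g, (hG _).2 ((hh.symm _).1 ((hG' _).1 g.2))⟩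
     left_inv := fun g => by ext1; ext1 y; simp [Equiv.permCongr_apply]
     right_inv := fun g => by ext1; ext1 y; simp [Equiv.permCongr_apply]
     map_mul' := fun g g' => by ext1; ext1 y; simp [Equiv.permCongr_apply] }⟩

theorem exists_conj_homeomorph (hn : 1 ≤ n) (hn' : 1 ≤ n') (hk : 2 ≤ k) (hk' : 2 ≤ k')
    {G : Subgroup (Equiv.Perm (Y n k r))} {G' : Subgroup (Equiv.Perm (Y n' k' r'))}
    (hG : ∀ g, g ∈ G ↔ Loc g) (hG' : ∀ g, g ∈ G' ↔ Loc g) (Φ : G ≃* G') :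
    ∃ h : Y n k r ≃ₜ Y n' k' r', Conj h.toEquiv := by
  have := ample hn hk hG
  have := ample hn' hk' hG'
  obtain ⟨h, hh⟩ := Rubin.exists_homeomorph (X := Y n k r) (X' := Y n' k' r') Φ
  have key : ∀ g : G, h.toEquiv.permCongr g = Φ g := fun g => by
    ext1 y
    have := hh g (h.symm y)
    rw [h.apply_symm_apply] at this
    exact this
  refine ⟨h, fun e => ⟨fun he => ?_, fun he => ?_⟩⟩
  · rw [key ⟨e, (hG e).2 he⟩]
    exact (hG' _).1 (Φ _).2
  · have h1 := key (Φ.symm ⟨_, (hG' _).2 he⟩)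
    rw [Φ.apply_symm_apply] at h1
    rw [← h.toEquiv.permCongr.injective h1]
    exact (hG _).1 (Subtype.property _)

variable {h : Y n k r ≃ₜ Y n' k' r'}

theorem exists_hasLag_single [NeZero k] (hk : 2 ≤ k) (hn : 1 ≤ n) (a : Fin r) (i : Fin n) :
    ∃ e : Equiv.Perm (Y n k r), Loc e ∧ e (fun _ _ => 0, a) = (fun _ _ => 0, a) ∧
      HasLag e (fun _ _ => 0, a) (Pi.single i 1) := by
  let c : Chart n k r := (fun _ => [], a)
  have hc : ∀ z, app c z = (z, a) := fun z => Prod.ext (funext fun i => concat_nil (z i)) rfl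
  have hz : ∀ b : Chart n k r, app (snoc b i 0) (fun _ _ => 0) = app b (fun _ _ => 0) := fun b => by
    rw [snoc, app_ext]
    congr 1
    funext i'
    by_cases h : i' = i
    · subst h
      funext m
      cases m <;> simp [concat]
    · simp [h, concat_nil]
  have hne : (range (app (snoc c i 0)))ᶜ.Nonempty := by
    refine ⟨app c fun _ _ => ⟨1, by omega⟩, fun h => ?_⟩
    have := app_mem_range_snoc.1 h
    simp [Fin.ext_iff] at this
  obtain ⟨e, he, h⟩ := exists_loc_app_eq hn hne (b := snoc (snoc c i 0) i 0)
    (hne.mono (compl_subset_compl.2 (range_app_ext _ _)))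
  have hx : ((fun _ _ => 0, a) : Y n k r) = app (snoc c i 0) fun _ _ => 0 := by rw [hz, hc]
  refine ⟨e, he, ?_, ?_⟩
  · rw [hx, h, hz]
  · refine ⟨_, _, _, hx, h, fun i' => ?_⟩
    by_cases h : i' = i
    · subst h
      simp [snoc, ext, c]
    · simp [snoc, ext, c, h]

theorem Conj.dim_le (hh : Conj h.toEquiv) (hn' : 1 ≤ n') (hk' : 2 ≤ k') (hr' : 1 ≤ r') :
    n' ≤ n := by
  have : NeZero k' := ⟨by omega⟩
  by_contra! hlt
  let y : Y n' k' r' := (fun _ _ => 0, ⟨0, hr'⟩)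
  choose g' hg' hgy' hlag' using exists_hasLag_single (r := r') hk' hn' ⟨0, hr'⟩
  let g : Fin n' → Equiv.Perm (Y n k r) := fun i => h.toEquiv.symm.permCongr (g' i)
  have hg : ∀ i, Loc (g i) := fun i => (hh.symm _).1 (hg' i)
  have hgx : ∀ i, g i (h.symm y) = h.symm y := fun i => by
    change h.symm (g' i (h (h.symm y))) = _
    rw [h.apply_symm_apply, hgy']
  choose l hl using fun i => (hg i).exists_hasLag (h.symm y)
  have hdep : ¬ LinearIndependent ℤ l := fun hli => by
    have := hli.fintype_card_le_finrank
    simp at this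
    omega
  obtain ⟨e, he, i, hi⟩ := Fintype.not_linearIndependent_iff.1 hdep
  have h1 : (List.ofFn fun i => ((g i, Multiplicative.ofAdd (l i)) : _ × _) ^ e i).prod ∈
      lagGroup (h.symm y) := by
    refine Subgroup.list_prod_mem _ fun p hp => ?_
    obtain ⟨i, rfl⟩ := (List.mem_ofFn' _ _).1 hp
    exact (lagGroup (h.symm y)).zpow_mem ⟨hgx i, hl i⟩ _
  have h2 : (List.ofFn fun i => ((g' i, Multiplicative.ofAdd (Pi.single i 1)) : _ × _) ^ e i).prod ∈
      lagGroup y := by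
    refine Subgroup.list_prod_mem _ fun p hp => ?_
    obtain ⟨i, rfl⟩ := (List.mem_ofFn' _ _).1 hp
    exact (lagGroup y).zpow_mem ⟨hgy' i, hlag' i⟩ _
  rw [snd_listProd_ofFn] at h1 h2
  rw [he] at h1
  have h3 := HasLag.eventually_eq h1.2 h1.1
  have hprod : h.toEquiv.permCongr (List.ofFn fun i => g i ^ e i).prod =
      (List.ofFn fun i => g' i ^ e i).prod := by
    have : ∀ p, h.toEquiv.permCongr p = h.toEquiv.permCongrHom p := fun _ => rfl
    rw [this, map_list_prod, List.map_ofFn]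
    congr 2
    funext i
    simp only [Function.comp_apply, map_zpow]
    congr 1
    ext1 z
    simp [g, Equiv.permCongrHom]
  have h4 : ∀ᶠ z in 𝓝 y, (List.ofFn fun i => g' i ^ e i).prod z = z := by
    filter_upwards [(h.symm.continuous.tendsto y).eventually h3] with z hz
    rw [← hprod]
    change h ((List.ofFn fun i => g i ^ e i).prod (h.symm z)) = z
    rw [hz, h.apply_symm_apply]
  have h5 := (HasLag.congr h2.2 h4).unique hk' (HasLag.id y)
  have h6 := congrFun h5 i
  simp [Finset.sum_apply, Pi.single_apply] at h6
  exact hi h6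

theorem exists_dec_succ [NeZero k] (hn : 1 ≤ n) (hr : 1 ≤ r) (j : Fin (k - 1)) :
    ∃ A : Set (Y n k r), Dec A (j + 1) ∧ A.Nonempty ∧ Aᶜ.Nonempty := by
  obtain ⟨c, hc⟩ := (dec_univ (n := n) (k := k) (r := r)).add_mul_pred hn hr 1
  have hj := j.2
  let ι : Fin (j + 1) → Fin (r + 1 * (k - 1)) := fun t => ⟨t, by omega⟩
  have hcn : ∀ t x, app (c t) x ∈ range (app (c t)) := fun t x => ⟨x, rfl⟩
  have huniq : ∀ s t x, app (c s) x ∈ range (app (c t)) → s = t := fun s t x hx =>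
    (hc.2 _ (mem_univ _)).unique (hcn s x) hx
  refine ⟨⋃ t, range (app (c (ι t))),
    ⟨fun t => c (ι t), fun t => subset_iUnion (fun t => range (app (c (ι t)))) t, ?_⟩, ?_, ?_⟩
  · intro y hy
    obtain ⟨t, x, rfl⟩ := mem_iUnion.1 hy
    refine ⟨t, hcn _ x, fun s hs => ?_⟩
    have := huniq _ _ x hs
    simp only [ι, Fin.mk.injEq] at this
    exact Fin.ext this.symm
  · exact ⟨app (c (ι 0)) fun _ _ => 0, mem_iUnion.2 ⟨0, hcn _ _⟩⟩
  · refine ⟨app (c ⟨j + 1, by omega⟩) fun _ _ => 0, fun hy => ?_⟩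
    obtain ⟨t, ht⟩ := mem_iUnion.1 hy
    have := huniq _ _ _ ht
    simp only [ι, Fin.mk.injEq] at this
    omega

theorem isClopen_image {A : Set (Y n k r)} (hA : IsClopen A) : IsClopen (h '' A) :=
  ⟨h.isClosedMap _ hA.1, h.isOpenMap _ hA.2⟩

theorem Conj.natCast_eq [NeZero k] (hh : Conj h.toEquiv) {A B : Set (Y n k r)} {p q : ℕ}
    (hA : Dec A p) (hB : Dec B q) {e : Equiv.Perm (Y n' k' r')} (he : Loc e)
    (heAB : e '' (h '' A) = h '' B) : (p : ZMod (k - 1)) = q := by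
  have h1 : Loc (h.toEquiv.symm.permCongr e) := (hh.symm e).1 he
  obtain ⟨m, hm1, hm2⟩ := h1.exists_dec_image hA.isClopen
  have h2 : h.toEquiv.symm.permCongr e '' A = B := by
    have : ⇑(h.toEquiv.symm.permCongr e) = h.symm ∘ e ∘ h := rfl
    rw [this, image_comp, image_comp, heAB, ← image_comp]
    simp
  rw [h2] at hm2
  rw [hA.natCast_eq hm1, hB.natCast_eq hm2]

theorem Conj.pred_le (hh : Conj h.toEquiv) (hn : 1 ≤ n) (hn' : 1 ≤ n') (hk : 2 ≤ k) (hk' : 2 ≤ k')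
    (hr : 1 ≤ r) : k - 1 ≤ k' - 1 := by
  have : NeZero k := ⟨by omega⟩
  have : NeZero k' := ⟨by omega⟩
  have : NeZero (k' - 1) := ⟨by omega⟩
  choose A hA hA1 hA2 using exists_dec_succ (k := k) hn hr
  choose q hq using fun j => exists_dec (isClopen_image (h := h) (hA j).isClopen)
  have hinj : Function.Injective fun j => (q j : ZMod (k' - 1)) := fun i j hij => by
    obtain ⟨e, he, hAB⟩ := exists_loc_image_eq_of_natCast_eq hn' (hq i) (hq j) hij
      ((hA1 i).image _) ((hA1 j).image _)
      (by rw [← image_compl_eq h.bijective]; exact (hA2 i).image _)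
      (by rw [← image_compl_eq h.bijective]; exact (hA2 j).image _)
    have := (ZMod.natCast_eq_natCast_iff' _ _ _).1 (hh.natCast_eq (hA i) (hA j) he hAB)
    have hi := i.2
    have hj := j.2
    refine Fin.ext ?_
    rcases Nat.lt_or_ge (i + 1 : ℕ) (k - 1) with h1 | h1 <;>
      rcases Nat.lt_or_ge (j + 1 : ℕ) (k - 1) with h2 | h2
    · rw [Nat.mod_eq_of_lt h1, Nat.mod_eq_of_lt h2] at this
      omega
    · rw [Nat.mod_eq_of_lt h1, show (j + 1 : ℕ) = k - 1 by omega, Nat.mod_self] at this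
      omega
    · rw [Nat.mod_eq_of_lt h2, show (i + 1 : ℕ) = k - 1 by omega, Nat.mod_self] at this
      omega
    · omega
  simpa [ZMod.card] using Fintype.card_le_of_injective _ hinj

theorem Conj.dvd (hh : Conj h.toEquiv) (hn : 1 ≤ n) (hk : 2 ≤ k) (hk' : 2 ≤ k') (hr : 1 ≤ r)
    {m : ℕ} (hmr : m ∣ r) (hmk : m ∣ k' - 1) : m ∣ r' := by
  have : NeZero k := ⟨by omega⟩
  have : NeZero k' := ⟨by omega⟩
  rcases Nat.lt_or_ge m 2 with hm | hm
  · interval_cases m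
    · have := Nat.eq_zero_of_zero_dvd hmk
      omega
    · exact one_dvd _
  obtain ⟨q, rfl⟩ := hmr
  have hq1 : 1 ≤ q := Nat.pos_of_ne_zero fun h => by simp [h] at hr
  let A : Fin m → Set (Y n k (m * q)) := fun s => {y | (finProdFinEquiv.symm y.2).1 = s}
  have hA : ∀ s, Dec (A s) q := fun s => by
    refine ⟨fun t => (fun _ => [], finProdFinEquiv (s, t)), ?_, fun y hy => ?_⟩
    · rintro t _ ⟨x, rfl⟩
      exact congrArg Prod.fst (finProdFinEquiv.symm_apply_apply (s, t))
    · refine ⟨(finProdFinEquiv.symm y.2).2, mem_range_app.2 ⟨?_, fun i j h => absurd h (by simp)⟩,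
        fun t ht => ?_⟩
      · rw [← Equiv.symm_apply_eq]
        exact Prod.ext hy rfl
      · have := (mem_range_app.1 ht).1
        rw [← Equiv.symm_apply_eq] at this
        exact (congrArg Prod.snd this).symm
  have hA1 : ∀ s, (A s).Nonempty := fun s =>
    ⟨(fun _ _ => 0, finProdFinEquiv (s, ⟨0, hq1⟩)),
      congrArg Prod.fst (finProdFinEquiv.symm_apply_apply (s, ⟨0, hq1⟩))⟩
  have hA2 : ∀ s, (A s)ᶜ.Nonempty := fun s => by
    have : Nontrivial (Fin m) := Fin.nontrivial_iff_two_le.2 hm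
    obtain ⟨t, ht⟩ := exists_ne s
    obtain ⟨y, hy⟩ := hA1 t
    exact ⟨y, fun hy' => ht (hy.symm.trans hy')⟩
  let s₀ : Fin m := ⟨0, by omega⟩
  choose e he heA using fun s => exists_loc_image_eq_of_natCast_eq hn (hA s₀) (hA s) rfl (hA1 s₀)
    (hA1 s) (hA2 s₀) (hA2 s)
  choose p hp using fun s => exists_dec (isClopen_image (h := h) (hA s).isClopen)
  have hps : ∀ s, (p s₀ : ZMod (k' - 1)) = p s := fun s => by
    refine hh.symm.natCast_eq (h := h.symm) (hp s₀) (hp s) (he s) ?_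
    simp only [← image_comp]
    simp [heA]
  have htot : Dec (univ : Set (Y n' k' r')) (∑ s, p s) := by
    refine Dec.sum (fun s => subset_univ _) (fun y _ => ?_) hp
    refine ⟨_, ⟨h.symm y, rfl, by simp⟩, ?_⟩
    rintro s ⟨z, hz, rfl⟩
    simpa using hz.symm
  have h1 := htot.natCast_eq dec_univ
  rw [Nat.cast_sum, Finset.sum_congr rfl fun s _ => (hps s).symm] at h1
  simp only [Finset.sum_const, Finset.card_univ, Fintype.card_fin, nsmul_eq_mul] at h1
  rw [← Nat.cast_mul, ZMod.natCast_eq_natCast_iff] at h1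
  exact (h1.dvd_iff hmk).1 (dvd_mul_right _ _)

end Conj

end NV

namespace NV

open Set Topology Filter

section Codes

variable {k : ℕ}

/-- The word `u` is a prefix of the sequence `z`. -/
def Pre (u : List (Fin k)) (z : Cantor k) : Prop := ∃ y, z = concat u y

theorem pre_append_iff {u v : List (Fin k)} {y : Cantor k} :
    Pre (u ++ v) (concat u y) ↔ Pre v y := by
  constructor
  · rintro ⟨x, hx⟩
    rw [concat_append] at hx
    exact ⟨x, concat_injective u hx⟩
  · rintro ⟨x, rfl⟩
    exact ⟨x, (concat_append u v x).symm⟩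

theorem Pre.of_append {u v : List (Fin k)} {z : Cantor k} (h : Pre (u ++ v) z) : Pre u z := by
  obtain ⟨x, rfl⟩ := h
  exact ⟨_, concat_append u v x⟩

/-- Lengthening of the word of a labelled word. -/
def app1 {α : Type*} (c : List (Fin k) × α) (v : List (Fin k)) : List (Fin k) × α := (c.1 ++ v, c.2)

/-- The closure properties of the relation of being identified on charts with labels in `α`. -/
structure IsChartRel {α : Type*} (E : List (Fin k) × α → List (Fin k) × α → Prop) : Prop where
  symm : ∀ {c c'}, E c c' → E c' c
  trans : ∀ {c c' c''}, E c c' → E c' c'' → E c c''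
  restrict : ∀ {c c'} v, E c c' → E (app1 c v) (app1 c v) → E (app1 c v) (app1 c' v)
  glue : ∀ {c c'}, (∀ z, ∃ v, Pre v z ∧ E (app1 c v) (app1 c' v)) → E c c'
  root : ∀ a, E ([], a) ([], a)

theorem IsChartRel.comap {α β : Type*} {E : List (Fin k) × α → List (Fin k) × α → Prop}
    (hE : IsChartRel E) (f : β → α) :
    IsChartRel fun c c' : List (Fin k) × β => E (c.1, f c.2) (c'.1, f c'.2) where
  symm h := hE.symm h
  trans h h' := hE.trans h h'
  restrict v h h' := hE.restrict v h h'
  glue h := hE.glue h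
  root a := hE.root (f a)

/-- A pair of labelled prefix codes that forces every chart relation to be total. -/
def Good (R : Bool → Multiset (List (Fin k) × Bool)) : Prop :=
  ∀ E : List (Fin k) × Bool → List (Fin k) × Bool → Prop, IsChartRel E →
    (∀ X, ∀ p ∈ R X, E ([], p.2) (p.1, X)) → ∀ c c', E c c'

open Classical in
/-- Every sequence has exactly one prefix in the code. -/
def IsCode (R : Multiset (List (Fin k) × Bool)) : Prop :=
  ∀ z, R.countP (fun p => Pre p.1 z) = 1

open Classical in
theorem IsCode.subst {w : List (Fin k)} {b : Bool} {R S : Multiset (List (Fin k) × Bool)}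
    (hR : IsCode ((w, b) ::ₘ R)) (hS : IsCode S) :
    IsCode (R + S.map fun p => (w ++ p.1, p.2)) := fun z => by
  have h := hR z
  rw [Multiset.countP_add, Multiset.countP_map, ← Multiset.countP_eq_card_filter]
  rw [Multiset.countP_cons] at h
  by_cases hw : Pre w z
  · obtain ⟨y, rfl⟩ := hw
    simp only [pre_append_iff]
    rw [hS y]
    rw [if_pos ⟨y, rfl⟩] at h
    omega
  · rw [if_neg hw] at h
    have h0 : S.countP (fun p => Pre (w ++ p.1) z) = 0 :=
      Multiset.countP_eq_zero.2 fun p _ hp => hw hp.of_append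
    rw [h0]
    omega

theorem Good.subst {R : Bool → Multiset (List (Fin k) × Bool)} (hR : Good R)
    (hcode : ∀ X, IsCode (R X)) {X : Bool} {w : List (Fin k)} {S : Multiset (List (Fin k) × Bool)}
    (hX : R X = (w, !X) ::ₘ S) :
    Good (Function.update R X (S + (R !X).map fun p => (w ++ p.1, p.2))) := fun E hE h => by
  classical
  have hne : (!X) ≠ X := by cases X <;> decide
  have h1 : ∀ p ∈ S + (R !X).map fun p => (w ++ p.1, p.2), E ([], p.2) (p.1, X) := fun p hp =>
    h X p (by rwa [Function.update_self])
  have h2 : ∀ p ∈ R !X, E ([], p.2) (p.1, !X) := fun p hp =>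
    h _ p (by rwa [Function.update_of_ne hne])
  refine hR E hE fun Y p hp => ?_
  by_cases hY : Y = X
  · subst hY
    rw [hX, Multiset.mem_cons] at hp
    rcases hp with rfl | hp
    · refine hE.glue fun z => ?_
      obtain ⟨q, hq, hqz⟩ := Multiset.countP_pos.1 (by rw [hcode (!Y) z]; exact one_pos)
      refine ⟨q.1, hqz, hE.trans (hE.symm (h2 q hq)) (h1 (w ++ q.1, q.2) ?_)⟩
      exact Multiset.mem_add.2 (.inr (Multiset.mem_map_of_mem _ hq))
    · exact h1 p (Multiset.mem_add.2 (.inl hp))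
  · have : Y = !X := by cases X <;> cases Y <;> simp_all
    subst this
    exact h2 p hp

theorem good_letters (lab : Fin k → Bool) :
    Good fun _ => Finset.univ.val.map fun j : Fin k => ([j], lab j) := fun E hE h => by
  have h1 : ∀ X j, E ([], lab j) ([j], X) := fun X j =>
    h X ([j], lab j) (Multiset.mem_map_of_mem _ (Finset.mem_univ_val j))
  have h2 : ∀ X X', E ([], X) ([], X') := fun X X' => hE.glue fun z =>
    ⟨[z 0], ⟨fun i => z (i + 1), by funext i; cases i <;> simp [concat]⟩,
      hE.trans (hE.symm (h1 X (z 0))) (h1 X' (z 0))⟩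
  have h3 : ∀ w X, E (w, X) ([], true) := fun w => by
    induction w with
    | nil => exact fun X => h2 X true
    | cons j w ih =>
      intro X
      have h4 := ih (lab j)
      exact hE.trans (hE.symm (hE.restrict w (h1 X j) (hE.trans h4 (hE.symm h4)))) h4
  exact fun c c' => hE.trans (h3 c.1 c.2) (hE.symm (h3 c'.1 c'.2))

open Classical in
theorem isCode_letters (lab : Fin k → Bool) :
    IsCode (Finset.univ.val.map fun j : Fin k => ([j], lab j)) := fun z => by
  rw [Multiset.countP_map, ← Multiset.countP_eq_card_filter]
  have : ∀ j, Pre [j] z ↔ z 0 = j := fun j => by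
    constructor
    · rintro ⟨y, rfl⟩; simp [concat]
    · rintro rfl
      exact ⟨fun i => z (i + 1), by funext i; cases i <;> simp [concat]⟩
  simp only [this]
  rw [← Multiset.count, Multiset.count_univ]

/-- The number of words with label `Y`. -/
def num (R : Multiset (List (Fin k) × Bool)) (Y : Bool) : ℕ := R.countP fun p => p.2 = Y

theorem num_add (R S : Multiset (List (Fin k) × Bool)) (Y : Bool) :
    num (R + S) Y = num R Y + num S Y := Multiset.countP_add _ _ _

theorem num_map (S : Multiset (List (Fin k) × Bool)) (w : List (Fin k)) (Y : Bool) :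
    num (S.map fun p => (w ++ p.1, p.2)) Y = num S Y := by
  rw [num, Multiset.countP_map, ← Multiset.countP_eq_card_filter]
  rfl

theorem num_cons (R : Multiset (List (Fin k) × Bool)) (w : List (Fin k)) (b Y : Bool) :
    num ((w, b) ::ₘ R) Y = num R Y + if b = Y then 1 else 0 := Multiset.countP_cons _ _ _

theorem exists_cons_of_num_pos {R : Multiset (List (Fin k) × Bool)} {Y : Bool} (h : 0 < num R Y) :
    ∃ w S, R = (w, Y) ::ₘ S := by
  obtain ⟨⟨w, b⟩, hp, hb⟩ := Multiset.countP_pos.1 h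
  obtain ⟨S, rfl⟩ := Multiset.exists_cons_of_mem hp
  exact ⟨w, S, by rw [← hb]⟩

theorem exists_good_aux (hk : 2 ≤ k) (N : ℕ) : ∀ σ τ m n : ℕ, σ + τ ≤ N → 1 ≤ σ → 1 ≤ τ →
    m * τ = n * σ + 1 → m ≤ σ * (k - 1) → n + 1 ≤ τ * (k - 1) →
    ∃ R : Bool → Multiset (List (Fin k) × Bool), Good R ∧ (∀ X, IsCode (R X)) ∧
      num (R false) false + m = σ * (k - 1) + 1 ∧ num (R false) true = m ∧
      num (R true) false + n = τ * (k - 1) ∧ num (R true) true = n + 1 := by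
  induction N with
  | zero => intro σ τ m n h1 h2; omega
  | succ N ih =>
    intro σ τ m n hN hσ hτ hmn hm hn
    rcases lt_trichotomy σ τ with h | rfl | h
    · obtain ⟨τ', rfl⟩ := Nat.exists_eq_add_of_lt h
      have hmle : m ≤ n := by
        by_contra! hlt
        nlinarith
      obtain ⟨n', rfl⟩ := Nat.exists_eq_add_of_le hmle
      have hn' : n' + 1 ≤ (τ' + 1) * (k - 1) := by
        by_contra! hlt
        nlinarith
      obtain ⟨R, hR, hc, c1, c2, c3, c4⟩ := ih σ (τ' + 1) m n' (by omega) hσ (by omega)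
        (by nlinarith) hm hn'
      obtain ⟨w, S, hS⟩ := exists_cons_of_num_pos (R := R true) (Y := false) (by omega)
      refine ⟨_, hR.subst hc (X := true) hS, fun X => ?_, ?_, ?_, ?_, ?_⟩
      · cases X
        · exact hc false
        · exact IsCode.subst (by rw [← hS]; exact hc true) (hc false)
      · exact c1
      · exact c2
      · rw [hS, num_cons] at c3
        simp only [Function.update_self, num_add, num_map, Bool.not_true]
        simp only [if_true] at c3
        have : (σ + τ' + 1) * (k - 1) = σ * (k - 1) + (τ' + 1) * (k - 1) := by ring
        omega
      · rw [hS, num_cons] at c4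
        simp only [Function.update_self, num_add, num_map, Bool.not_true]
        simp at c4
        omega
    · have hσ1 : σ ∣ 1 := (Nat.dvd_add_right (dvd_mul_left σ n)).1 (hmn ▸ dvd_mul_left σ m)
      obtain rfl := Nat.dvd_one.1 hσ1
      have hlab : (Finset.univ.filter fun j : Fin k => (j : ℕ) < m).card = m := by
        rw [Fin.card_filter_val_lt]; omega
      have h1 : num (Finset.univ.val.map fun j : Fin k => ([j], decide ((j : ℕ) < m))) true
          = m := by
        refine Eq.trans ?_ hlab
        rw [num, Multiset.countP_map, Finset.card_def, Finset.filter_val]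
        simp only [decide_eq_true_eq]
      have h2 : num (Finset.univ.val.map fun j : Fin k => ([j], decide ((j : ℕ) < m))) false + m
          = k := by
        have := Finset.card_filter_add_card_filter_not (s := (Finset.univ : Finset (Fin k)))
          (fun j => (j : ℕ) < m)
        rw [hlab, Finset.card_univ, Fintype.card_fin] at this
        have h3 : num (Finset.univ.val.map fun j : Fin k => ([j], decide ((j : ℕ) < m))) false
            = (Finset.univ.filter fun j : Fin k => ¬ (j : ℕ) < m).card := by
          rw [num, Multiset.countP_map, Finset.card_def, Finset.filter_val]
          simp only [decide_eq_false_iff_not]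
        omega
      refine ⟨_, good_letters fun j => decide ((j : ℕ) < m), fun X => isCode_letters _, ?_, h1, ?_,
        ?_⟩ <;> omega
    · obtain ⟨σ', rfl⟩ := Nat.exists_eq_add_of_lt h
      have hmle : n ≤ m := by
        by_contra! hlt
        nlinarith
      obtain ⟨m', rfl⟩ := Nat.exists_eq_add_of_le hmle
      have e : m' * τ = n * (σ' + 1) + 1 := by nlinarith
      have hm' : m' ≤ (σ' + 1) * (k - 1) := by
        by_contra! hlt
        nlinarith
      have hm1 : 1 ≤ m' := by
        by_contra! hlt
        interval_cases m'
        omega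
      obtain ⟨R, hR, hc, c1, c2, c3, c4⟩ := ih (σ' + 1) τ m' n (by omega) (by omega) hτ e hm' hn
      obtain ⟨w, S, hS⟩ := exists_cons_of_num_pos (R := R false) (Y := true) (by omega)
      refine ⟨_, hR.subst hc (X := false) hS, fun X => ?_, ?_, ?_, ?_, ?_⟩
      · cases X
        · exact IsCode.subst (by rw [← hS]; exact hc false) (hc true)
        · exact hc true
      · rw [hS, num_cons] at c1
        simp only [Function.update_self, num_add, num_map, Bool.not_false]
        simp at c1
        have : (τ + σ' + 1) * (k - 1) = τ * (k - 1) + (σ' + 1) * (k - 1) := by ring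
        omega
      · rw [hS, num_cons] at c2
        simp only [Function.update_self, num_add, num_map, Bool.not_false]
        simp only [if_true] at c2
        omega
      · exact c3
      · exact c4

end Codes

end NV

namespace NV

open Set Topology Filter

section Systems

variable {k s : ℕ}

/-- The parametrization of a labelled cone. -/
def capp {α : Type*} (c : List (Fin k) × α) (z : Cantor k) : Cantor k × α := (concat c.1 z, c.2)

theorem capp_injective {α : Type*} (c : List (Fin k) × α) : Function.Injective (capp c) :=
  fun _ _ h => concat_injective c.1 (congrArg Prod.fst h)

theorem capp_app1 {α : Type*} (c : List (Fin k) × α) (v : List (Fin k)) (z : Cantor k) :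
    capp (app1 c v) z = capp c (concat v z) := by
  simp [capp, app1, concat_append]

/-- A family of `k` branches of `Cantor k × Fin (s + 2)`, the branch `i` mapping the piece with
label `a` onto the labelled cone `D i a`. Every branch is constant on labels or shifts them. -/
structure IsSystem (D : Fin k → Fin (s + 2) → List (Fin k) × Fin (s + 2)) : Prop where
  part : ∀ x : Cantor k × Fin (s + 2), ∃! q : Fin k × Fin (s + 2), ∃ z, x = capp (D q.1 q.2) z
  label : ∀ i, (∃ b, ∀ a, (D i a).2 = b) ∨ ∀ a, ((D i a).2 : ℕ) = min ((a : ℕ) + 1) (s + 1)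

variable (D : Fin k → Fin (s + 2) → List (Fin k) × Fin (s + 2))

/-- The action of a word through the branches. -/
def act (w : List (Fin k)) (x : Cantor k × Fin (s + 2)) : Cantor k × Fin (s + 2) :=
  w.foldr (fun i y => capp (D i y.2) y.1) x

theorem act_append (w v : List (Fin k)) (x : Cantor k × Fin (s + 2)) :
    act D (w ++ v) x = act D w (act D v x) := List.foldr_append

theorem act_cons (i : Fin k) (v : List (Fin k)) (x : Cantor k × Fin (s + 2)) :
    act D (i :: v) x = act D [i] (act D v x) := rfl

theorem act_singleton_capp (i : Fin k) (c : List (Fin k) × Fin (s + 2)) (z : Cantor k) :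
    act D [i] (capp c z) = capp ((D i c.2).1 ++ c.1, (D i c.2).2) z := by
  simp [act, capp, concat_append]

theorem exists_act_eq_capp (w : List (Fin k)) (a : Fin (s + 2)) :
    ∃ c, ∀ z, act D w (z, a) = capp c z := by
  induction w with
  | nil => exact ⟨([], a), fun z => by simp [act, capp, concat_nil]⟩
  | cons i w ih =>
    obtain ⟨c, hc⟩ := ih
    exact ⟨_, fun z => by rw [act_cons, hc, act_singleton_capp]⟩

/-- Two labelled cones are identified if corresponding points are locally images of the same points
under two words. -/
def Rel (c c' : List (Fin k) × Fin (s + 2)) : Prop :=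
  ∀ z, ∃ w v y₀, capp c z = act D w y₀ ∧ capp c' z = act D v y₀ ∧
    ∀ y, ∃ z', capp c z' = act D w y ∧ capp c' z' = act D v y

variable {D}

theorem Rel.act {c c' : List (Fin k) × Fin (s + 2)} (h : Rel D c c') (i : Fin k) :
    Rel D c ((D i c'.2).1 ++ c'.1, (D i c'.2).2) := fun z => by
  obtain ⟨w, v, y, h1, h2, h3⟩ := h z
  simp only [← act_singleton_capp]
  exact ⟨w, i :: v, y, h1, by rw [h2, ← act_cons],
    fun y => (h3 y).imp fun _ h => ⟨h.1, by rw [h.2, ← act_cons]⟩⟩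

namespace IsSystem

theorem existsUnique_digit (hD : IsSystem D) (x : Cantor k × Fin (s + 2)) :
    ∃! p : Fin k × (Cantor k × Fin (s + 2)), x = act D [p.1] p.2 := by
  obtain ⟨⟨i, a⟩, ⟨z, hz⟩, hu⟩ := hD.part x
  refine ⟨(i, (z, a)), hz, ?_⟩
  rintro ⟨j, y, b⟩ hj
  obtain ⟨rfl, rfl⟩ := Prod.ext_iff.1 (hu (j, b) ⟨y, hj⟩)
  have := capp_injective _ (hz.symm.trans hj)
  subst this
  rfl

theorem act_eq_act (hD : IsSystem D) {w v : List (Fin k)} {x y : Cantor k × Fin (s + 2)}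
    (h : act D w x = act D v y) (hl : w.length ≤ v.length) : ∃ t, v = w ++ t ∧ x = act D t y := by
  induction w generalizing v with
  | nil => exact ⟨v, rfl, h⟩
  | cons i w ih =>
    cases v with
    | nil => simp at hl
    | cons j v =>
      rw [act_cons, act_cons D j] at h
      obtain ⟨rfl, h'⟩ := Prod.ext_iff.1 ((hD.existsUnique_digit _).unique
        (y₁ := (i, act D w x)) rfl (y₂ := (j, act D v y)) h)
      obtain ⟨t, rfl, ht⟩ := ih h' (by simpa using hl)
      exact ⟨t, rfl, ht⟩

theorem act_snd (hD : IsSystem D) (w : List (Fin k)) :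
    (∃ b, ∀ y, (act D w y).2 = b) ∨ ∀ y, ((act D w y).2 : ℕ) = min (y.2 + w.length) (s + 1) := by
  induction w with
  | nil => exact .inr fun y => by have := y.2.2; simp [act]; omega
  | cons i w ih =>
    rcases ih with ⟨b, hb⟩ | ih
    · exact .inl ⟨(D i b).2, fun y => congrArg (fun a => (D i a).2) (hb y)⟩
    · rcases hD.label i with ⟨b, hb⟩ | h
      · exact .inl ⟨b, fun y => hb _⟩
      · refine .inr fun y => (h _).trans ?_
        change min (((act D w y).2 : ℕ) + 1) (s + 1) = _
        rw [ih, List.length_cons]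
        omega

theorem exists_act_eq (hD : IsSystem D) (N : ℕ) (x : Cantor k × Fin (s + 2)) :
    ∃ w y, w.length = N ∧ x = act D w y := by
  induction N generalizing x with
  | zero => exact ⟨[], x, rfl, rfl⟩
  | succ N ih =>
    obtain ⟨p, hp, -⟩ := hD.existsUnique_digit x
    obtain ⟨w, y, hw, hy⟩ := ih p.2
    exact ⟨p.1 :: w, y, by simp [hw], by rw [act_cons, ← hy]; exact hp⟩

theorem isChartRel_rel (hD : IsSystem D) : IsChartRel (Rel D) where
  symm h z := by
    obtain ⟨w, v, y, h1, h2, h3⟩ := h z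
    exact ⟨v, w, y, h2, h1, fun y => (h3 y).imp fun _ h => h.symm⟩
  trans {c c' c''} h h' z := by
    obtain ⟨w, v, y, h1, h2, h3⟩ := h z
    obtain ⟨p, q, y', h1', h2', h3'⟩ := h' z
    have he := h2.symm.trans h1'
    rcases le_total v.length p.length with hl | hl
    · obtain ⟨t, rfl, rfl⟩ := hD.act_eq_act he hl
      refine ⟨w ++ t, q, y', by rw [act_append, h1], h2', fun x => ?_⟩
      obtain ⟨z', e1, e2⟩ := h3 (act D t x)
      obtain ⟨z'', e1', e2'⟩ := h3' x
      rw [act_append, ← e2] at e1'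
      obtain rfl := capp_injective _ e1'
      exact ⟨_, by rw [act_append, e1], e2'⟩
    · obtain ⟨t, rfl, rfl⟩ := hD.act_eq_act he.symm hl
      refine ⟨w, q ++ t, y, h1, by rw [act_append, h2'], fun x => ?_⟩
      obtain ⟨z', e1, e2⟩ := h3 x
      obtain ⟨z'', e1', e2'⟩ := h3' (act D t x)
      rw [act_append, ← e1'] at e2
      obtain rfl := capp_injective _ e2
      exact ⟨_, e1, by rw [act_append, e2']⟩
  restrict {c c'} u h h' z := by
    obtain ⟨w, _, y, h1, -, h3⟩ := h' z
    obtain ⟨p, q, y', h1', h2', h3'⟩ := h (concat u z)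
    rw [capp_app1] at h1
    have he := h1.symm.trans h1'
    simp only [capp_app1] at h3 ⊢
    rcases le_total w.length p.length with hl | hl
    · obtain ⟨t, rfl, rfl⟩ := hD.act_eq_act he hl
      refine ⟨w ++ t, q, y', h1', h2', fun x => ?_⟩
      obtain ⟨z', e1, -⟩ := h3 (act D t x)
      obtain ⟨z'', e1', e2'⟩ := h3' x
      rw [act_append, ← e1] at e1'
      obtain rfl := capp_injective _ e1'
      exact ⟨z', by rw [act_append, e1], e2'⟩
    · obtain ⟨t, rfl, rfl⟩ := hD.act_eq_act he.symm hl
      refine ⟨p ++ t, q ++ t, y, h1, by rw [act_append, h2'], fun x => ?_⟩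
      obtain ⟨z', e1, -⟩ := h3 x
      obtain ⟨z'', e1', e2'⟩ := h3' (act D t x)
      rw [act_append, ← e1'] at e1
      obtain rfl := capp_injective _ e1
      exact ⟨z', by rw [act_append, e1'], by rw [act_append, e2']⟩
  glue {c c'} h z := by
    obtain ⟨u, ⟨z, rfl⟩, hu⟩ := h z
    obtain ⟨w, v, y, h1, h2, h3⟩ := hu z
    simp only [capp_app1] at h1 h2 h3
    exact ⟨w, v, y, h1, h2, fun y => (h3 y).elim fun z' hz => ⟨_, hz⟩⟩
  root a z := by
    obtain ⟨w, y, hw, hy⟩ := hD.exists_act_eq (s + 1) (z, a)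
    refine ⟨w, w, y, by simpa [capp, concat_nil] using hy, by simpa [capp, concat_nil] using hy,
      fun x => ⟨(act D w x).1, and_self_iff.2 (Prod.ext (concat_nil _) ?_)⟩⟩
    change a = _
    refine (congrArg Prod.snd hy).trans ?_
    rcases hD.act_snd w with ⟨b, hb⟩ | h
    · rw [hb, hb]
    · refine Fin.ext ?_
      rw [h, h]
      omega

theorem rel_apply (hD : IsSystem D) (i : Fin k) (a : Fin (s + 2)) : Rel D ([], a) (D i a) := by
  simpa using (hD.isChartRel_rel.root a).act i

theorem rel (hD : IsSystem D) {R : Bool → Multiset (List (Fin k) × Bool)} (hR : Good R)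
    (leaf : ∀ X, ∀ p ∈ R X, ∃ i a, (p.2 = true ↔ a = Fin.last (s + 1)) ∧
      D i a = (p.1, if X then Fin.last (s + 1) else 0))
    (mid : ∀ b : Fin s, ∃ i, D i b.castSucc.castSucc = ([], b.succ.castSucc))
    (c c' : List (Fin k) × Fin (s + 2)) : Rel D c c' := by
  have hE := hD.isChartRel_rel
  have h1 : ∀ a : Fin (s + 1), Rel D ([], 0) ([], a.castSucc) := fun a => by
    induction a using Fin.induction with
    | zero => exact hE.root 0
    | succ b ih =>
      obtain ⟨i, hi⟩ := mid b
      exact hE.trans ih (hi ▸ hD.rel_apply i _)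
  have h2 := hR _ (hE.comap fun X : Bool => if X then Fin.last (s + 1) else 0) fun X p hp => by
    obtain ⟨i, a, ha, hi⟩ := leaf X p hp
    simp only [← hi]
    refine hE.trans ?_ (hD.rel_apply i a)
    induction a using Fin.lastCases with
    | last => rw [ha.2 rfl]; exact hE.root _
    | cast a =>
      rw [if_neg fun h => (Fin.castSucc_lt_last a).ne (ha.1 h)]
      exact h1 a
  have h3 : ∀ c, Rel D ([], 0) c := by
    rintro ⟨w, a⟩
    induction a using Fin.lastCases with
    | last => exact h2 ([], false) (w, true)
    | cast a =>
      exact hE.trans (h2 ([], false) (w, false))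
        (hE.restrict w (h1 a) (h2 (w, false) (w, false)))
  exact hE.trans (hE.symm (h3 c)) (h3 c')

/-- A bijection that conjugates the prefix maps to the branches. -/
theorem exists_equiv [NeZero k] (hD : IsSystem D) (hrel : ∀ c, Rel D c c) :
    ∃ φ : Cantor k ≃ Cantor k × Fin (s + 2), ∀ w z, φ (concat w z) = act D w (φ z) := by
  choose p hp hu using hD.existsUnique_digit
  let S : Cantor k × Fin (s + 2) → Cantor k × Fin (s + 2) := fun x => (p x).2
  let code : Cantor k × Fin (s + 2) → Cantor k := fun x n => (p (S^[n] x)).1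
  have code_cons : ∀ i x, code (act D [i] x) = concat [i] (code x) := fun i x => by
    have h1 : (i, x) = p (act D [i] x) := hu _ (i, x) rfl
    funext n
    cases n with
    | zero => simp [code, concat, ← h1]
    | succ n => simp [code, concat, S, ← h1]
  have code_act : ∀ w x, code (act D w x) = concat w (code x) := fun w x => by
    induction w with
    | nil => exact (concat_nil _).symm
    | cons i w ih => rw [act_cons, code_cons, ih, ← concat_append]; rfl
  have act_code : ∀ w z x, code x = concat w z → ∃ y, x = act D w y := fun w z => by
    induction w generalizing z with
    | nil => exact fun x _ => ⟨x, rfl⟩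
    | cons i w ih =>
      intro x hx
      have h1 := hp x
      have h2 : code x = concat [(p x).1] (code (p x).2) := by
        conv_lhs => rw [h1]
        exact code_cons _ _
      have h3 : (p x).1 = i := by
        have := congrFun (h2.symm.trans hx) 0
        simpa [concat] using this
      rw [hx, h3, ← List.singleton_append, concat_append] at h2
      obtain ⟨y, hy⟩ := ih z _ (concat_injective _ h2).symm
      exact ⟨y, by rw [act_cons, ← hy, ← h3]; exact h1⟩
  have hinj : Function.Injective code := fun x x' h => by
    have key : ∀ N, x'.2 = x.2 ∧ ∀ i < N, x'.1 i = x.1 i := fun N => by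
      obtain ⟨w, v, y, h1, -, h3⟩ := hrel (pre N x.1, x.2) fun i => x.1 (N + i)
      have h1' : x = act D w y := by rw [← h1, capp, concat_pre]
      obtain ⟨y', hy'⟩ := act_code w (code y) x' (by rw [← h, h1', code_act])
      obtain ⟨z', hz', -⟩ := h3 y'
      rw [← hy'] at hz'
      rw [← hz']
      exact ⟨rfl, fun i hi => concat_ofFn (fun i : Fin N => x.1 i) z' ⟨i, hi⟩⟩
    exact (Prod.ext (funext fun i => (key (i + 1)).2 i (by omega)) (key 0).1).symm
  have hsurj : Function.Surjective code := fun ξ => by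
    have hcont : ∀ w, Continuous (act D w) := fun w => by
      refine continuous_prod_of_discrete_right.2 fun a => ?_
      obtain ⟨c, hc⟩ := exists_act_eq_capp D w a
      simp only [hc]
      exact (continuous_concat c.1).prodMk continuous_const
    obtain ⟨x, hx⟩ := IsCompact.nonempty_iInter_of_sequence_nonempty_isCompact_isClosed
      (fun N => range (act D (pre N ξ)))
      (fun N => by
        rintro _ ⟨y, rfl⟩
        have : pre (N + 1) ξ = pre N ξ ++ [ξ N] := List.ofFn_succ_last
        exact ⟨act D [ξ N] y, by rw [this, act_append]⟩)
      (fun N => ⟨_, (0, 0), rfl⟩) (isCompact_range (hcont _))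
      (fun N => (isCompact_range (hcont _)).isClosed)
    refine ⟨x, funext fun n => ?_⟩
    obtain ⟨y, rfl⟩ := mem_iInter.1 hx (n + 1)
    rw [code_act]
    exact concat_ofFn (fun i : Fin (n + 1) => ξ i) _ ⟨n, by omega⟩
  refine ⟨(Equiv.ofBijective code ⟨hinj, hsurj⟩).symm, fun w z => ?_⟩
  rw [Equiv.symm_apply_eq]
  refine (Eq.trans ?_ (code_act _ _).symm)
  congr 1
  exact ((Equiv.ofBijective code ⟨hinj, hsurj⟩).apply_symm_apply z).symm

end IsSystem

end Systems

end NV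

namespace NV

open Set Topology Filter

section Recoding

variable {k s n r : ℕ}

/-- Recoding of the first coordinate by a bijection onto finitely many copies of Cantor space. -/
def recode [NeZero n] (φ : Cantor k ≃ Cantor k × Fin (s + 2)) : Y n k r ≃ Y n k (r * (s + 2)) where
  toFun x := (Function.update x.1 0 (φ (x.1 0)).1, finProdFinEquiv (x.2, (φ (x.1 0)).2))
  invFun y := (Function.update y.1 0 (φ.symm (y.1 0, (finProdFinEquiv.symm y.2).2)),
    (finProdFinEquiv.symm y.2).1)
  left_inv x := by simp
  right_inv y := by
    simp only
    rw [Function.update_self, Function.update_idem, Equiv.apply_symm_apply, Prod.mk.eta,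
      Equiv.apply_symm_apply, Function.update_eq_self]

theorem recode_app [NeZero n] {φ : Cantor k ≃ Cantor k × Fin (s + 2)} {c : Chart n k r}
    {t : Fin n → Cantor k} {d : List (Fin k) × Fin (s + 2)} {z : Cantor k}
    (h : φ (concat (c.1 0) (t 0)) = capp d z) :
    recode φ (app c t) =
      app (Function.update c.1 0 d.1, finProdFinEquiv (c.2, d.2)) (Function.update t 0 z) := by
  refine Prod.ext (funext fun i => ?_) ?_
  · change Function.update (app c t).1 0 (φ (concat (c.1 0) (t 0))).1 i = _
    rw [h]
    by_cases hi : i = 0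
    · subst hi
      simp [app, capp]
    · simp [app, hi]
  · change finProdFinEquiv (c.2, (φ (concat (c.1 0) (t 0))).2) = _
    rw [h]
    rfl

theorem conj_recode [NeZero n] {D : Fin k → Fin (s + 2) → List (Fin k) × Fin (s + 2)}
    (hrel : ∀ c c', Rel D c c') {φ : Cantor k ≃ Cantor k × Fin (s + 2)}
    (hφ : ∀ w z, φ (concat w z) = act D w (φ z)) :
    Conj (recode φ : Y n k r ≃ Y n k (r * (s + 2))) := fun e => by
  constructor
  · intro he y
    obtain ⟨x, rfl⟩ := (recode φ).surjective y
    obtain ⟨c, d, t, rfl, h⟩ := he x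
    obtain ⟨c', hc'⟩ := exists_act_eq_capp D (c.1 0) (φ (t 0)).2
    obtain ⟨d', hd'⟩ := exists_act_eq_capp D (d.1 0) (φ (t 0)).2
    refine ⟨_, (Function.update d.1 0 d'.1, finProdFinEquiv (d.2, d'.2)), _,
      recode_app ((hφ _ _).trans (hc' _)), fun t' => ?_⟩
    let t'' := Function.update t' 0 (φ.symm (t' 0, (φ (t 0)).2))
    have h0 : φ (t'' 0) = (t' 0, (φ (t 0)).2) := by simp [t'']
    have h1 : Function.update t'' 0 (t' 0) = t' := by simp [t'']
    have h2 := recode_app (c := c) (t := t'') ((hφ _ _).trans (h0 ▸ hc' _))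
    have h3 := recode_app (c := d) (t := t'') ((hφ _ _).trans (h0 ▸ hd' _))
    rw [h1] at h2 h3
    rw [← h2, ← h3, Equiv.permCongr_apply, Equiv.symm_apply_apply, h]
  · intro he x
    obtain ⟨⟨c, i⟩, ⟨d, j⟩, t, ht, h⟩ := he (recode φ x)
    obtain ⟨⟨a, α⟩, rfl⟩ := finProdFinEquiv.surjective i
    obtain ⟨⟨b, β⟩, rfl⟩ := finProdFinEquiv.surjective j
    obtain ⟨w, v, y, h1, -, h3⟩ := hrel (c 0, α) (d 0, β) (t 0)
    have key : ∀ (c : Fin n → List (Fin k)) (a : Fin r) (α : Fin (s + 2)) (t' : Fin n → Cantor k)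
        (w : List (Fin k)) (z : Cantor k), capp (c 0, α) z = act D w (φ (t' 0)) →
        recode φ (app (Function.update c 0 w, a) t') =
          app (c, finProdFinEquiv (a, α)) (Function.update t' 0 z) := fun c a α t' w z hz => by
      have := recode_app (c := (Function.update c 0 w, a)) (t := t') (φ := φ) (d := (c 0, α))
        (z := z) (by rw [hφ, hz]; simp)
      simpa using this
    refine ⟨(Function.update c 0 w, a), (Function.update d 0 v, b),
      Function.update t 0 (φ.symm y), ?_, fun t' => ?_⟩
    · apply (recode φ).injective
      rw [ht, key c a α _ w (t 0) (by simpa using h1)]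
      simp
    · obtain ⟨z', e1, e2⟩ := h3 (φ (t' 0))
      apply (recode φ).injective
      rw [key d b β _ v z' e2, ← h, Equiv.permCongr_apply, ← key c a α _ w z' e1,
        Equiv.symm_apply_apply]

end Recoding

end NV

namespace NV

open Set Topology Filter

section Existence

variable {k s m n : ℕ}

theorem exists_map_univ_eq {α ι : Type*} [Fintype ι] {M : Multiset α}
    (h : M.card = Fintype.card ι) : ∃ f : ι → α, Finset.univ.val.map f = M := by
  induction M using Quotient.inductionOn with | h l => ?_
  change l.length = _ at h
  let e : ι ≃ Fin l.length := Fintype.equivFinOfCardEq h.symm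
  refine ⟨fun i => l.get (e i), ?_⟩
  have h1 : (Finset.univ : Finset (Fin l.length)).val.map l.get = (l : Multiset α) := by
    rw [Fin.univ_val_map, List.ofFn_get]
  rw [← Finset.map_univ_equiv e, Finset.map_val, Multiset.map_map] at h1
  exact h1

theorem IsCode.exists_index {ι κ : Type*} [Fintype ι] [Fintype κ]
    {R : Multiset (List (Fin k) × Bool)} (hR : IsCode R) (h0 : num R false = Fintype.card ι)
    (h1 : num R true = Fintype.card κ) :
    ∃ (f : ι → List (Fin k)) (g : κ → List (Fin k)),
      (∀ z, ∃! e : ι ⊕ κ, Pre (Sum.elim f g e) z) ∧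
      ∀ p ∈ R, (∃ i, p = (f i, false)) ∨ ∃ j, p = (g j, true) := by
  classical
  rw [num, Multiset.countP_eq_card_filter] at h0 h1
  obtain ⟨f, hf⟩ := exists_map_univ_eq h0
  obtain ⟨g, hg⟩ := exists_map_univ_eq h1
  have hR' : R = Finset.univ.val.map (Sum.elim f g) := by
    rw [← Finset.univ_disjSum_univ, Finset.val_disjSum, Multiset.disjSum, Multiset.map_add,
      Multiset.map_map, Multiset.map_map, Sum.elim_comp_inl, Sum.elim_comp_inr, hf, hg]
    conv_lhs => rw [← Multiset.filter_add_not (fun p => p.2 = false) R]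
    simp
  have hf' : ∀ i, (f i).2 = false := fun i =>
    (Multiset.mem_filter (p := fun p : List (Fin k) × Bool => p.2 = false).1
      (hf ▸ Multiset.mem_map_of_mem f (Finset.mem_univ_val i))).2
  have hg' : ∀ i, (g i).2 = true := fun i =>
    (Multiset.mem_filter (p := fun p : List (Fin k) × Bool => p.2 = true).1
      (hg ▸ Multiset.mem_map_of_mem g (Finset.mem_univ_val i))).2
  refine ⟨fun i => (f i).1, fun j => (g j).1, fun z => ?_, fun p hp => ?_⟩
  · have h2 := hR z
    rw [hR', Multiset.countP_map] at h2
    change (Finset.univ.filter fun e => Pre (Sum.elim f g e).1 z).card = 1 at h2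
    obtain ⟨e, he⟩ := Finset.card_eq_one.1 h2
    have h3 : ∀ e', Pre (Sum.elim (fun i => (f i).1) (fun j => (g j).1) e') z ↔ e' = e :=
      fun e' => by
        rw [← Finset.mem_singleton, ← he, Finset.mem_filter]
        cases e' <;> simp
    exact ⟨e, (h3 e).2 rfl, fun e' => (h3 e').1⟩
  · rw [hR', Multiset.mem_map] at hp
    obtain ⟨i | j, -, rfl⟩ := hp
    · exact .inl ⟨i, Prod.ext rfl (hf' i)⟩
    · exact .inr ⟨j, Prod.ext rfl (hg' j)⟩

/-- The branches assembled from a code for the first and a code for the last label. The branches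
of the first kind go to the first label, the other ones to the last label, except for a shift of the
labels. -/
def branches (fA : Fin m × Fin (s + 1) → List (Fin k)) (gA : Fin m → List (Fin k))
    (fB : Option (Fin n × Fin (s + 1)) → List (Fin k)) (gB : Option (Fin n) → List (Fin k)) :
    Fin m ⊕ Option (Fin n) → Fin (s + 2) → List (Fin k) × Fin (s + 2)
  | .inl i => Fin.lastCases (gA i, 0) fun b => (fA (i, b), 0)
  | .inr (some i) => Fin.lastCases (gB (some i), Fin.last _) fun b => (fB (some (i, b)), Fin.last _)
  | .inr none => Fin.lastCases (gB none, Fin.last _)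
      (Fin.lastCases (fB none, Fin.last _) fun b => ([], b.succ.castSucc))

section Branches

variable {fA : Fin m × Fin (s + 1) → List (Fin k)} {gA : Fin m → List (Fin k)}
  {fB : Option (Fin n × Fin (s + 1)) → List (Fin k)} {gB : Option (Fin n) → List (Fin k)}

theorem branches_part (hA : ∀ z, ∃! e, Pre (Sum.elim fA gA e) z)
    (hB : ∀ z, ∃! e, Pre (Sum.elim fB gB e) z) (x : Cantor k × Fin (s + 2)) :
    ∃! q : (Fin m ⊕ Option (Fin n)) × Fin (s + 2),
      ∃ z, x = capp (branches fA gA fB gB q.1 q.2) z := by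
  obtain ⟨z, α⟩ := x
  have h : ∀ c : List (Fin k) × Fin (s + 2), (∃ y, (z, α) = capp c y) ↔ Pre c.1 z ∧ α = c.2 := by
    simp [capp, Pre, Prod.ext_iff]
  simp only [h]
  have hne : ∀ b : Fin s, b.succ.castSucc ≠ 0 := fun b h => by simpa using congrArg Fin.val h
  have hne' : ∀ b : Fin s, b.succ.castSucc ≠ Fin.last (s + 1) := fun b =>
    (Fin.castSucc_lt_last _).ne
  have hlast : (0 : Fin (s + 2)) ≠ Fin.last (s + 1) := (Fin.last_pos).ne
  induction α using Fin.lastCases with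
  | last =>
    obtain ⟨e, he, hu⟩ := hB z
    refine existsUnique_of_exists_of_unique ?_ ?_
    · rcases e with (_ | ⟨i, b⟩) | (_ | i)
      · exact ⟨(.inr none, (Fin.last s).castSucc), by simpa [branches] using he⟩
      · exact ⟨(.inr (some i), b.castSucc), by simpa [branches] using he⟩
      · exact ⟨(.inr none, Fin.last _), by simpa [branches] using he⟩
      · exact ⟨(.inr (some i), Fin.last _), by simpa [branches] using he⟩
    · have key : ∀ q : (Fin m ⊕ Option (Fin n)) × Fin (s + 2),
          Pre (branches fA gA fB gB q.1 q.2).1 z ∧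
            Fin.last _ = (branches fA gA fB gB q.1 q.2).2 →
          q = Sum.elim
            (fun o => o.elim (.inr none, (Fin.last s).castSucc)
              fun p => (.inr (some p.1), p.2.castSucc))
            (fun o => (.inr o, Fin.last _)) e := by
        rintro ⟨j | _ | j, a⟩ ⟨h1, h2⟩
        · induction a using Fin.lastCases <;> simp [branches, hlast.symm] at h2
        · induction a using Fin.lastCases with
          | last => rw [← hu (.inr none) (by simpa [branches] using h1)]; rfl
          | cast a =>
            induction a using Fin.lastCases with
            | last => rw [← hu (.inl none) (by simpa [branches] using h1)]; rfl
            | cast a => exact absurd h2.symm (by simp [branches, -Fin.castSucc_succ, hne'])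
        · induction a using Fin.lastCases with
          | last => rw [← hu (.inr (some j)) (by simpa [branches] using h1)]; rfl
          | cast a => rw [← hu (.inl (some (j, a))) (by simpa [branches] using h1)]; rfl
      exact fun q q' hq hq' => (key q hq).trans (key q' hq').symm
  | cast α =>
    induction α using Fin.cases with
    | zero =>
      obtain ⟨e, he, hu⟩ := hA z
      refine existsUnique_of_exists_of_unique ?_ ?_
      · rcases e with ⟨i, b⟩ | i
        · exact ⟨(.inl i, b.castSucc), by simpa [branches] using he⟩
        · exact ⟨(.inl i, Fin.last _), by simpa [branches] using he⟩
      · have key : ∀ q : (Fin m ⊕ Option (Fin n)) × Fin (s + 2),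
            Pre (branches fA gA fB gB q.1 q.2).1 z ∧
              (0 : Fin (s + 1)).castSucc = (branches fA gA fB gB q.1 q.2).2 →
            q = Sum.elim (fun p => (.inl p.1, p.2.castSucc)) (fun i => (.inl i, Fin.last _)) e := by
          rintro ⟨j | _ | j, a⟩ ⟨h1, h2⟩
          · induction a using Fin.lastCases with
            | last => rw [← hu (.inr j) (by simpa [branches] using h1)]; rfl
            | cast a => rw [← hu (.inl (j, a)) (by simpa [branches] using h1)]; rfl
          · induction a using Fin.lastCases with
            | last => simp [branches, hlast] at h2
            | cast a =>
              induction a using Fin.lastCases with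
              | last => simp [branches, hlast] at h2
              | cast a => exact absurd h2.symm (by simp [branches])
          · induction a using Fin.lastCases <;> simp [branches, hlast] at h2
        exact fun q q' hq hq' => (key q hq).trans (key q' hq').symm
    | succ b =>
      refine ⟨(.inr none, b.castSucc.castSucc), by simp [branches, Pre, concat_nil], ?_⟩
      rintro ⟨i | _ | i, a⟩ ⟨h1, h2⟩ <;> induction a using Fin.lastCases with
      | last => simp_all [branches]
      | cast a =>
        first
        | (simp_all [branches]; done)
        | induction a using Fin.lastCases <;> simp_all [branches]

theorem branches_label (j : Fin m ⊕ Option (Fin n)) :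
    (∃ b, ∀ a, (branches fA gA fB gB j a).2 = b) ∨
      ∀ a, ((branches fA gA fB gB j a).2 : ℕ) = min ((a : ℕ) + 1) (s + 1) := by
  rcases j with i | _ | i
  · exact .inl ⟨0, fun a => by induction a using Fin.lastCases <;> simp [branches]⟩
  · refine .inr fun a => ?_
    induction a using Fin.lastCases with
    | last => simp [branches]
    | cast a =>
      induction a using Fin.lastCases with
      | last => simp [branches]
      | cast a => simp [branches]
  · exact .inl ⟨Fin.last _, fun a => by induction a using Fin.lastCases <;> simp [branches]⟩

end Branches

theorem exists_coefficients (hk : 2 ≤ k) (hs : (s + 2).Coprime (k - 1)) :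
    ∃ σ τ m n : ℕ, 1 ≤ σ ∧ 1 ≤ τ ∧ m * τ = n * σ + 1 ∧ m ≤ σ * (k - 1) ∧ n + 1 ≤ τ * (k - 1) ∧
      m + (n + 1) = k ∧ (s + 2) * m = σ * (k - 1) + 1 ∧ (s + 2) * n + 1 = τ * (k - 1) := by
  obtain ⟨K, rfl⟩ := Nat.exists_eq_add_of_le hk
  have hK : 2 + K - 1 = K + 1 := by omega
  rw [hK] at hs ⊢
  have hc : (((K + 1 : ℕ) : ZMod (s + 2)))  * ((K + 1 : ℕ) : ZMod (s + 2))⁻¹ = 1 :=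
    ZMod.coe_mul_inv_eq_one _ hs.symm
  set x : ZMod (s + 2) := -((K + 1 : ℕ) : ZMod (s + 2))⁻¹ with hx
  have h1 : ((x.val * (K + 1) + 1 : ℕ) : ZMod (s + 2)) = 0 := by
    rw [Nat.cast_add, Nat.cast_mul, ZMod.natCast_zmod_val, hx, neg_mul, mul_comm, hc]
    simp
  obtain ⟨m, hm⟩ := (ZMod.natCast_eq_zero_iff _ _).1 h1
  have h2 : x.val < s + 2 := ZMod.val_lt x
  have h3 : x.val ≠ 0 := fun h => by
    rw [h, zero_mul, zero_add] at hm
    have := Nat.dvd_one.1 ⟨m, hm⟩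
    omega
  generalize x.val = σ at *
  obtain ⟨τ, hτ⟩ := Nat.exists_eq_add_of_lt h2
  have hmK : m ≤ K + 1 := by
    by_contra! hlt
    nlinarith
  obtain ⟨n, hn⟩ := Nat.exists_eq_add_of_le hmK
  have h4 : (s + 2) * n + 1 = (τ + 1) * (K + 1) := by
    have : (s + 2) * (K + 1) = (s + 2) * m + (s + 2) * n := by rw [hn, mul_add]
    have : (s + 2) * (K + 1) = σ * (K + 1) + (τ + 1) * (K + 1) := by rw [hτ]; ring
    omega
  refine ⟨σ, τ + 1, m, n, by omega, by omega, ?_, ?_, ?_, by omega, hm.symm, h4⟩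
  · have h5 : m * (s + 2) = m * σ + m * (τ + 1) := by rw [hτ]; ring
    have h6 : σ * (K + 1) = m * σ + n * σ := by rw [hn]; ring
    rw [mul_comm] at h5
    omega
  · have : 1 ≤ σ * (K + 1) := Nat.mul_pos (by omega) (by omega)
    nlinarith
  · nlinarith

theorem exists_isSystem (hk : 2 ≤ k) (hs : (s + 2).Coprime (k - 1)) :
    ∃ D : Fin k → Fin (s + 2) → List (Fin k) × Fin (s + 2), IsSystem D ∧ ∀ c c', Rel D c c' := by
  obtain ⟨σ, τ, m, n, hσ, hτ, h1, h2, h3, h4, h5, h6⟩ := exists_coefficients hk hs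
  obtain ⟨R, hR, hcode, c1, c2, c3, c4⟩ := exists_good_aux hk _ σ τ m n le_rfl hσ hτ h1 h2 h3
  obtain ⟨fA, gA, hA, hA'⟩ := (hcode false).exists_index (ι := Fin m × Fin (s + 1)) (κ := Fin m)
    (by
      rw [Fintype.card_prod, Fintype.card_fin, Fintype.card_fin]
      have : (s + 2) * m = m * (s + 1) + m := by ring
      omega) (by simpa using c2)
  obtain ⟨fB, gB, hB, hB'⟩ := (hcode true).exists_index (ι := Option (Fin n × Fin (s + 1)))
    (κ := Option (Fin n))
    (by
      rw [Fintype.card_option, Fintype.card_prod, Fintype.card_fin, Fintype.card_fin]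
      have : (s + 2) * n = n * (s + 1) + n := by ring
      omega) (by simpa using c4)
  let e : Fin k ≃ Fin m ⊕ Option (Fin n) := (Fintype.equivFinOfCardEq (by simp [h4])).symm
  have hD : IsSystem fun i => branches fA gA fB gB (e i) := by
    refine ⟨fun x => ?_, fun i => branches_label _⟩
    obtain ⟨q, hq, hu⟩ := branches_part hA hB x
    refine ⟨(e.symm q.1, q.2), by simpa using hq, fun q' hq' => ?_⟩
    rw [← hu (e q'.1, q'.2) hq', e.symm_apply_apply]
  refine ⟨_, hD, hD.rel hR ?_ fun b => ⟨e.symm (.inr none), by simp [branches]⟩⟩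
  have key : ∀ X, ∀ p ∈ R X, ∃ j a, (p.2 = true ↔ a = Fin.last (s + 1)) ∧
      branches fA gA fB gB j a = (p.1, if X then Fin.last (s + 1) else 0) := by
    rintro (_ | _) p hp
    · rcases hA' p hp with ⟨⟨i, b⟩, rfl⟩ | ⟨i, rfl⟩
      · exact ⟨.inl i, b.castSucc, by simp [branches]⟩
      · exact ⟨.inl i, Fin.last _, by simp [branches]⟩
    · rcases hB' p hp with ⟨_ | ⟨i, b⟩, rfl⟩ | ⟨_ | i, rfl⟩
      · exact ⟨.inr none, (Fin.last s).castSucc, by simp [branches]⟩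
      · exact ⟨.inr (some i), b.castSucc, by simp [branches]⟩
      · exact ⟨.inr none, Fin.last _, by simp [branches]⟩
      · exact ⟨.inr (some i), Fin.last _, by simp [branches]⟩
  intro X p hp
  obtain ⟨j, a, h⟩ := key X p hp
  exact ⟨e.symm j, a, by simpa using h⟩

end Existence

end NV

namespace NV

section Classification

variable {n k r r' : ℕ}

theorem exists_conj_of_modEq (hn : 1 ≤ n) (hk : 2 ≤ k) (hr : 1 ≤ r) (hr' : 1 ≤ r')
    (h : r ≡ r' [MOD k - 1]) : ∃ e : Y n k r ≃ Y n k r', Conj e := by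
  have : NeZero k := ⟨by omega⟩
  wlog hle : r ≤ r' generalizing r r'
  · obtain ⟨e, he⟩ := this hr' hr h.symm (le_of_not_ge hle)
    exact ⟨e.symm, he.symm⟩
  obtain ⟨j, hj⟩ := (Nat.modEq_iff_dvd' hle).1 h
  have hdec := (dec_univ (n := n) (k := k) (r := r)).add_mul_pred hn hr j
  rw [show r + j * (k - 1) = r' by rw [mul_comm, ← hj]; omega] at hdec
  obtain ⟨c, hc⟩ := hdec
  obtain ⟨d, hd⟩ := dec_univ (n := n) (k := k) (r := r')
  obtain ⟨e, he, -⟩ := exists_equiv_of_isDec hc hd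
  exact ⟨e, he.conj⟩

theorem exists_conj_mul (hn : 1 ≤ n) (hk : 2 ≤ k) {s : ℕ} (hs : (s + 2).Coprime (k - 1)) :
    ∃ e : Y n k r ≃ Y n k (r * (s + 2)), Conj e := by
  have : NeZero k := ⟨by omega⟩
  have : NeZero n := ⟨by omega⟩
  obtain ⟨D, hD, hrel⟩ := exists_isSystem hk hs
  obtain ⟨φ, hφ⟩ := hD.exists_equiv fun c => hrel c c
  exact ⟨_, conj_recode hrel hφ⟩

theorem exists_coprime_mul_modEq {K : ℕ} (hK : 1 ≤ K) (h : K.gcd r = K.gcd r') :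
    ∃ s : ℕ, (s + 2).Coprime K ∧ r * (s + 2) ≡ r' [MOD K] := by
  have : NeZero K := ⟨by omega⟩
  have key : ∀ r : ℕ, ∃ v : (ZMod K)ˣ, (r : ZMod K) = (K.gcd r : ℕ) * v := fun r => by
    obtain ⟨d, hd, u, hu, hr⟩ := ZMod.eq_unit_mul_divisor (r : ZMod K)
    obtain ⟨u, rfl⟩ := hu
    refine ⟨u, ?_⟩
    have h1 : r ≡ (u : ZMod K).val * d [MOD K] := by
      rw [← ZMod.natCast_eq_natCast_iff, hr, Nat.cast_mul, ZMod.natCast_zmod_val]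
    have h2 : K.gcd r = d := by
      rw [Nat.gcd_comm, h1.gcd_eq, Nat.Coprime.gcd_mul_left_cancel _ (ZMod.val_coe_unit_coprime u),
        Nat.gcd_eq_left hd]
    rw [h2, hr, mul_comm]
  obtain ⟨v, hv⟩ := key r
  obtain ⟨v', hv'⟩ := key r'
  have h1 : ((v⁻¹ * v' : (ZMod K)ˣ) : ZMod K).val + (2 * K - 2) + 2 =
      ((v⁻¹ * v' : (ZMod K)ˣ) : ZMod K).val + 2 * K := by omega
  refine ⟨((v⁻¹ * v' : (ZMod K)ˣ) : ZMod K).val + (2 * K - 2), ?_, ?_⟩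
  · rw [h1, Nat.coprime_add_mul_right_left]
    exact ZMod.val_coe_unit_coprime _
  · rw [h1, ← ZMod.natCast_eq_natCast_iff]
    push_cast
    rw [ZMod.natCast_zmod_val, hv, hv', h]
    simp [mul_assoc]

theorem exists_conj_of_gcd_eq (hn : 1 ≤ n) (hk : 2 ≤ k) (hr : 1 ≤ r) (hr' : 1 ≤ r')
    (h : (k - 1).gcd r = (k - 1).gcd r') : ∃ e : Y n k r ≃ Y n k r', Conj e := by
  obtain ⟨s, hs, hmod⟩ := exists_coprime_mul_modEq (by omega) h
  obtain ⟨e, he⟩ := exists_conj_mul (r := r) hn hk hs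
  obtain ⟨e', he'⟩ := exists_conj_of_modEq hn hk (Nat.mul_pos hr (by omega)) hr' hmod
  exact ⟨e.trans e', he.trans he'⟩

end Classification

end NV

theorem statement4 (n n' k k' r r' : ℕ) (hn : 1 ≤ n) (hn' : 1 ≤ n')
    (hk : 2 ≤ k) (hk' : 2 ≤ k') (hr : 1 ≤ r) (hr' : 1 ≤ r')
    (G : Subgroup (Equiv.Perm (NV.Y n k r)))
    (hG : (G : Set (Equiv.Perm (NV.Y n k r))) = NV.thompsonSet n k r)
    (G' : Subgroup (Equiv.Perm (NV.Y n' k' r')))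
    (hG' : (G' : Set (Equiv.Perm (NV.Y n' k' r'))) = NV.thompsonSet n' k' r') :
    Nonempty (↥G ≃* ↥G') ↔
      (n = n' ∧ k = k' ∧ Nat.gcd (k - 1) r = Nat.gcd (k' - 1) r') := by
  have : NeZero k := ⟨by omega⟩
  have : NeZero k' := ⟨by omega⟩
  have h1 : ∀ g, g ∈ G ↔ NV.Loc g := fun g => by
    rw [← SetLike.mem_coe, hG]; exact NV.isElement_iff
  have h2 : ∀ g, g ∈ G' ↔ NV.Loc g := fun g => by
    rw [← SetLike.mem_coe, hG']; exact NV.isElement_iff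
  constructor
  · rintro ⟨Φ⟩
    obtain ⟨h, hh⟩ := NV.exists_conj_homeomorph hn hn' hk hk' h1 h2 Φ
    have hh' : NV.Conj h.symm.toEquiv := hh.symm
    obtain rfl := le_antisymm (hh'.dim_le hn hk hr) (hh.dim_le hn' hk' hr')
    have hkk := le_antisymm (hh.pred_le hn hn hk hk' hr) (hh'.pred_le hn hn hk' hk hr')
    obtain rfl : k = k' := by omega
    refine ⟨rfl, rfl, Nat.dvd_antisymm ?_ ?_⟩
    · exact Nat.dvd_gcd (Nat.gcd_dvd_left _ _)
        (hh.dvd hn hk hk hr (Nat.gcd_dvd_right _ _) (Nat.gcd_dvd_left _ _))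
    · exact Nat.dvd_gcd (Nat.gcd_dvd_left _ _)
        (hh'.dvd hn hk hk hr' (Nat.gcd_dvd_right _ _) (Nat.gcd_dvd_left _ _))
  · rintro ⟨rfl, rfl, hgcd⟩
    obtain ⟨e, he⟩ := NV.exists_conj_of_gcd_eq hn hk hr hr' hgcd
    exact he.nonempty_mulEquiv h1 h2
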